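/- arXiv:2401.01957 — 2 statements merged into one kernel-verified Lean document; each statement's English description precedes it below -/
import Mathlib

section
/- Fix a pattern σ ∈ S_3 (a permutation of {1,2,3}). For each n, let Π_n^σ be a uniformly random permutation of [n] conditioned to avoid σ, regarded as a random element of the space F(ℕ, ℕ*) of functions from ℕ to the one-point compactification ℕ* = ℕ ∪ {∞} (with the topology of pointwise convergence) by setting Π_n^σ(k) = k for k > n. Then there exists an F(ℕ, ℕ*)-valued random variable Π^σ such that Π_n^σ converges in distribution to Π^σ as n → ∞. -/
open Set Filter MeasureTheory Topology TopologicalSpace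
open scoped ENNReal

namespace AvoidPaper

/-- Instances for the codomain `ℕ∞` (one-point compactification of `ℕ`). -/
instance : SecondCountableTopology ℕ∞ := by
  have h : ({s : Set ℕ∞ | ∃ a, s = Set.Ioi a ∨ s = Set.Iio a}).Countable := by
    have hsub : {s : Set ℕ∞ | ∃ a, s = Set.Ioi a ∨ s = Set.Iio a}
        ⊆ Set.range (Set.Ioi : ℕ∞ → Set ℕ∞) ∪ Set.range (Set.Iio : ℕ∞ → Set ℕ∞) := by
      rintro s ⟨a, rfl | rfl⟩
      · exact Or.inl ⟨a, rfl⟩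
      · exact Or.inr ⟨a, rfl⟩
    exact ((Set.countable_range _).union (Set.countable_range _)).mono hsub
  exact SecondCountableTopology.mk' h

instance : OpensMeasurableSpace ℕ∞ := ⟨le_top⟩

/-! ## Ulam–Harris vertices and rooted ordered trees -/

/-- A vertex of the Ulam–Harris tree: a finite list of natural numbers (children indices),
ordered lexicographically (so an ancestor precedes its descendants). -/
abbrev Vertex : Type := List ℕ

/-- A (rooted ordered) tree: contains the root, is closed under ancestors, and is
left-closed among siblings. -/
def IsTree (t : Set Vertex) : Prop :=
  ([] : Vertex) ∈ t ∧ (∀ u v : Vertex, u ++ v ∈ t → u ∈ t) ∧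
    ∀ (u : Vertex) (i j : ℕ), u ++ [i] ∈ t → j ≤ i → u ++ [j] ∈ t

/-- The set of children indices of `u` in `t`. -/
def children (t : Set Vertex) (u : Vertex) : Set ℕ := {i | u ++ [i] ∈ t}

/-- Locally finite tree. -/
def LocFin (t : Set Vertex) : Prop := ∀ u : Vertex, (children t u).Finite

/-- Number of children of `u` in `t`. -/
noncomputable def childCount (t : Set Vertex) (u : Vertex) : ℕ := (children t u).ncard

/-- The degree function `d_t(u)`: number of children, and `-1` if `u ∉ t`. -/
noncomputable def deg (t : Set Vertex) (u : Vertex) : ℤ :=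
  haveI := Classical.dec (u ∈ t)
  if u ∈ t then (childCount t u : ℤ) else -1

/-- `t^[m]`: restriction of `t` to the vertices of height at most `m`. -/
def trunc (t : Set Vertex) (m : ℕ) : Set Vertex := {u ∈ t | u.length ≤ m}

/-- Local convergence of trees: `d_{t_n}(u) → d_t(u)` for every vertex `u`
(equivalently, eventual equality, since degrees are integers). -/
def LocalConv (ts : ℕ → Set Vertex) (t : Set Vertex) : Prop :=
  ∀ u : Vertex, ∀ᶠ n in atTop, deg (ts n) u = deg t u

/-- A leaf: a vertex of `t` with no children. -/
def IsLeaf (t : Set Vertex) (v : Vertex) : Prop := v ∈ t ∧ ∀ i : ℕ, v ++ [i] ∉ t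

def leafSet (t : Set Vertex) : Set Vertex := {v | IsLeaf t v}

/-- The fringe subtree `t_v` of `t` at `v` (as a subset of `t`). -/
def fringe (t : Set Vertex) (v : Vertex) : Set Vertex := {x ∈ t | v <+: x}

/-- Number of vertices of `t` at height exactly `k`. -/
noncomputable def levelCount (t : Set Vertex) (k : ℕ) : ℕ := {u ∈ t | u.length = k}.ncard

/-- An infinite spine of `t`: `η 0` is the root and `η (i+1)` is a child of `η i`. -/
def IsSpine (t : Set Vertex) (η : ℕ → Vertex) : Prop :=
  η 0 = [] ∧ (∀ i, η i ∈ t) ∧ ∀ i, ∃ c : ℕ, η (i + 1) = η i ++ [c]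

/-- `v` lies strictly to the left of the spine `η`. -/
def LeftOfSpine (t : Set Vertex) (η : ℕ → Vertex) (v : Vertex) : Prop :=
  v ∈ t ∧ (∀ i, η i ≠ v) ∧ ∃ j, v < η j

/-- `v` lies strictly to the right of the spine `η`. -/
def RightOfSpine (t : Set Vertex) (η : ℕ → Vertex) (v : Vertex) : Prop :=
  v ∈ t ∧ ∀ j, η j < v

/-- `η` is the unique infinite spine of `t`, with infinitely many subtrees attached to
the left and to the right of the spine, infinitely many of the left ones having at
least two vertices. -/
def SpineSpec (t : Set Vertex) (η : ℕ → Vertex) : Prop :=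
  IsSpine t η ∧ (∀ η', IsSpine t η' → η' = η) ∧
  {u : Vertex | (∃ k c, u = η k ++ [c]) ∧ LeftOfSpine t η u}.Infinite ∧
  {u : Vertex | (∃ k c, u = η k ++ [c]) ∧ RightOfSpine t η u}.Infinite ∧
  {u : Vertex | (∃ k c, u = η k ++ [c]) ∧ LeftOfSpine t η u ∧
      2 ≤ (fringe t u).encard}.Infinite

/-- `𝔗_f`: finite trees with at least two vertices. -/
def MemTf (t : Set Vertex) : Prop := IsTree t ∧ t.Finite ∧ 2 ≤ t.encard

/-- `𝔗_∞`. -/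
def MemTinf (t : Set Vertex) : Prop :=
  IsTree t ∧ LocFin t ∧ t.Infinite ∧ ∃ η : ℕ → Vertex, SpineSpec t η

/-- The leaves of `t` lying to the left of the spine `η`. -/
def leftLeaves (t : Set Vertex) (η : ℕ → Vertex) : Set Vertex :=
  {x | IsLeaf t x ∧ LeftOfSpine t η x}

/-- `v` is the enumeration `(v_{t,i})` of (an initial part of) `t` in increasing
lexicographic order: `v i ∈ t` and the vertices of `t` smaller than `v i` are
exactly `v 0, …, v (i-1)`. -/
def IsLexEnum (t : Set Vertex) (v : ℕ → Vertex) : Prop :=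
  ∀ i : ℕ, (i : ℕ∞) < t.encard →
    v i ∈ t ∧ {x ∈ t | x < v i} = v '' {j | j < i}

/-- `w` is the enumeration `(w_{t,i})` of (a final part of) `t` in decreasing
lexicographic order, starting from the lexicographically largest vertex. -/
def IsLexCoEnum (t : Set Vertex) (w : ℕ → Vertex) : Prop :=
  ∀ i : ℕ, (i : ℕ∞) < t.encard →
    w i ∈ t ∧ {x ∈ t | w i < x} = w '' {j | j < i}

/-- `l` enumerates the set `A` in increasing lexicographic order. -/
def IsEnumOf (A : Set Vertex) (l : ℕ → Vertex) : Prop :=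
  ∀ i : ℕ, (i : ℕ∞) < A.encard →
    l i ∈ A ∧ {x ∈ A | x < l i} = l '' {j | j < i}

/-- `s_i`: the number of vertices of `t` lexicographically smaller than the `i`-th leaf
(0-indexed: `l 0` is the paper's `l_1`). -/
noncomputable def sVal (t : Set Vertex) (l : ℕ → Vertex) (i : ℕ) : ℕ :=
  {x ∈ t | x < l i}.ncard

/-- `p_i`: the height of the `i`-th leaf. -/
def pVal (l : ℕ → Vertex) (i : ℕ) : ℕ := (l i).length

/-! ## The maps Φ^σ -/

/-- `Φ^{231}` as an element of `F(ℕ, ℕ*)` (value `i` outside the range of indices). -/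
noncomputable def phi231 (t : Set Vertex) (v : ℕ → Vertex) : ℕ → ℕ∞ := fun i =>
  if 1 ≤ i ∧ (i : ℕ∞) < t.encard then
    ((i : ℕ∞) + (fringe t (v i)).encard) - ((v i).length : ℕ∞)
  else (i : ℕ∞)

noncomputable def phi213 (t : Set Vertex) (v : ℕ → Vertex) : ℕ → ℕ∞ := fun i =>
  if 1 ≤ i ∧ (i : ℕ∞) < t.encard then
    ((t \ fringe t (v i)).encard + ((v i).length : ℕ∞)) - (i : ℕ∞)
  else (i : ℕ∞)

noncomputable def phi312 (t : Set Vertex) (w : ℕ → Vertex) : ℕ → ℕ∞ := fun i =>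
  if 1 ≤ i ∧ (i : ℕ∞) < t.encard then
    ((i : ℕ∞) + ((w (i - 1)).length : ℕ∞)) - (fringe t (w (i - 1))).encard
  else (i : ℕ∞)

noncomputable def phi132 (t : Set Vertex) (w : ℕ → Vertex) : ℕ → ℕ∞ := fun i =>
  if 1 ≤ i ∧ (i : ℕ∞) < t.encard then
    ((t.encard + (fringe t (w (i - 1))).encard) - (i : ℕ∞)) - ((w (i - 1)).length : ℕ∞)
  else (i : ℕ∞)

/-- `B = {s_i - p_i + 1 : i}` (with `i` ranging over indices `< L` of leaves). -/
def Bset (S P : ℕ → ℕ) (L : ℕ∞) : Set ℕ :=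
  {b | ∃ i : ℕ, (i : ℕ∞) < L ∧ S i - P i + 1 = b}

/-- `A = {s_i : i}`. -/
def Aset (S : ℕ → ℕ) (L : ℕ∞) : Set ℕ := {a | ∃ i : ℕ, (i : ℕ∞) < L ∧ S i = a}

/-- The number of elements of `C` in `{1, …, j}`. -/
noncomputable def rankIn (C : Set ℕ) (j : ℕ) : ℕ := (C ∩ Set.Icc 1 j).ncard

/-- The `a`-th smallest positive element of `C`. -/
noncomputable def nthOf (C : Set ℕ) (a : ℕ) : ℕ :=
  sInf {m : ℕ | a ≤ (C ∩ Set.Icc 1 m).ncard}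

open Classical in
/-- `Φ^{321}` built from the data `s, p` (and the number `L` of leaves):
`s_i - p_i + 1 ↦ s_i`, extended by the unique increasing bijection between the
complements (and by the identity outside `[1, n]` in the finite case). -/
noncomputable def phi321Fun (S P : ℕ → ℕ) (L : ℕ∞) : ℕ → ℕ∞ := fun j =>
  if h : j ∈ Bset S P L then (S h.choose : ℕ∞)
  else (nthOf (Aset S L)ᶜ (rankIn (Bset S P L)ᶜ j) : ℕ∞)

/-- `Φ^{123} = |t| + 1 - Φ^{321}` as an element of `F(ℕ, ℕ*)`. -/
noncomputable def phi123Fun (tc : ℕ∞) (f : ℕ → ℕ∞) : ℕ → ℕ∞ := fun j =>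
  if 1 ≤ j ∧ (j : ℕ∞) < tc then (tc + 1) - f j else (j : ℕ∞)

/-! ## Patterns and pattern avoidance -/

def p123 : Equiv.Perm (Fin 3) := Equiv.refl _
noncomputable def p321 : Equiv.Perm (Fin 3) := Equiv.ofBijective ![2, 1, 0] (by decide)
noncomputable def p231 : Equiv.Perm (Fin 3) := Equiv.ofBijective ![1, 2, 0] (by decide)
noncomputable def p213 : Equiv.Perm (Fin 3) := Equiv.ofBijective ![1, 0, 2] (by decide)
noncomputable def p312 : Equiv.Perm (Fin 3) := Equiv.ofBijective ![2, 0, 1] (by decide)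
noncomputable def p132 : Equiv.Perm (Fin 3) := Equiv.ofBijective ![0, 2, 1] (by decide)

/-- `π` contains the length-3 pattern `σ`. -/
def ContainsPat {n : ℕ} (π : Equiv.Perm (Fin n)) (σ : Equiv.Perm (Fin 3)) : Prop :=
  ∃ f : Fin 3 → Fin n, StrictMono f ∧ ∀ j k : Fin 3, σ j < σ k ↔ π (f j) < π (f k)

/-- `π` avoids the length-3 pattern `σ`. -/
def AvoidsPat {n : ℕ} (π : Equiv.Perm (Fin n)) (σ : Equiv.Perm (Fin 3)) : Prop :=
  ¬ ContainsPat π σ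

/-- Trees with `n+1` vertices. -/
def TreeN (n : ℕ) : Type := {t : Set Vertex // IsTree t ∧ t.encard = (n : ℕ∞) + 1}

/-- Embedding of a permutation of `[n]` into `F(ℕ, ℕ*)` by `π(k) = k` for `k > n`
(permutations are `1`-indexed: position `k ∈ [1, n]` corresponds to `k - 1 : Fin n`). -/
noncomputable def embedPerm {n : ℕ} (π : Equiv.Perm (Fin n)) : ℕ → ℕ∞ := fun k =>
  if h : 1 ≤ k ∧ k ≤ n then (((π ⟨k - 1, by omega⟩ : Fin n) : ℕ) + 1 : ℕ) else (k : ℕ∞)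

/-- The (finite) set of permutations of `[n]` avoiding `σ`. -/
noncomputable def avoidFinset (σ : Equiv.Perm (Fin 3)) (n : ℕ) : Finset (Equiv.Perm (Fin n)) :=
  Set.Finite.toFinset (Set.toFinite {π : Equiv.Perm (Fin n) | AvoidsPat π σ})

/-- The law of a uniformly random `σ`-avoiding permutation of `[n]`,
as a measure on `F(ℕ, ℕ*)`. -/
noncomputable def uniformAvoidLaw (σ : Equiv.Perm (Fin 3)) (n : ℕ) : Measure (ℕ → ℕ∞) :=
  ((avoidFinset σ n).card : ℝ≥0∞)⁻¹ • ∑ π ∈ avoidFinset σ n, Measure.dirac (embedPerm π)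


open Classical in
/-- `Φ^σ` for an arbitrary pattern `σ ∈ S_3`, given a tree together with its increasing
vertex enumeration `v`, its decreasing vertex enumeration `w`, and the increasing
enumeration `l` of the relevant set `Lset` of leaves. -/
noncomputable def PhiOf (σ : Equiv.Perm (Fin 3)) (t : Set Vertex)
    (v w l : ℕ → Vertex) (Lset : Set Vertex) : ℕ → ℕ∞ :=
  if σ = p231 then phi231 t v
  else if σ = p213 then phi213 t v
  else if σ = p312 then phi312 t w
  else if σ = p132 then phi132 t w
  else if σ = p321 then phi321Fun (sVal t l) (pVal l) Lset.encard
  else phi123Fun t.encard (phi321Fun (sVal t l) (pVal l) Lset.encard)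

open Classical in
noncomputable def canonSpine (t : Set Vertex) : ℕ → Vertex :=
  if h : ∃ η : ℕ → Vertex, IsSpine t η then h.choose else fun _ => []

open Classical in
noncomputable def canonV (t : Set Vertex) : ℕ → Vertex :=
  if h : ∃ v : ℕ → Vertex, IsLexEnum t v then h.choose else fun _ => []

open Classical in
noncomputable def canonW (t : Set Vertex) : ℕ → Vertex :=
  if h : ∃ w : ℕ → Vertex, IsLexCoEnum t w then h.choose else fun _ => []

open Classical in
noncomputable def canonL (t : Set Vertex) : ℕ → Vertex :=
  if h : ∃ l : ℕ → Vertex, IsEnumOf (leftLeaves t (canonSpine t)) l then h.choose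
  else fun _ => []

/-- `Φ^σ_t` for an infinite tree `t ∈ 𝔗_∞`, using the canonical (unique) spine and
enumerations. -/
noncomputable def PhiCanon (σ : Equiv.Perm (Fin 3)) (t : Set Vertex) : ℕ → ℕ∞ :=
  PhiOf σ t (canonV t) (canonW t) (canonL t) (leftLeaves t (canonSpine t))

/-- σ-algebra on the space of trees: all sets are measurable. -/
instance : MeasurableSpace (Set Vertex) := ⊤

/-- `μ` is the law of a Galton–Watson tree with offspring distribution `ξ`:
a probability measure, supported on trees, giving each finite tree `t` the
probability `∏_{u ∈ t} ξ(d_t(u))`. -/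
def IsGW (ξ : ℕ → ℝ≥0∞) (μ : Measure (Set Vertex)) : Prop :=
  IsProbabilityMeasure μ ∧ μ {t | IsTree t} = 1 ∧
    ∀ t : Set Vertex, IsTree t → ∀ ht : t.Finite,
      μ {t} = ∏ u ∈ ht.toFinset, ξ (childCount t u)

/-- `π` is the permutation `Φ^{321}_t` of `[n]` associated to a finite tree `t` with
`n+1` vertices: for every leaf `v` with `s = #{x ∈ t : x < v}` and `p = |v|`, position
`s - p + 1` is mapped to `s` (in 0-indexed form: position `s - p` to value `s - 1`),
and `π` is increasing on the remaining positions. -/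
def Is321Image (n : ℕ) (t : Set Vertex) (π : Equiv.Perm (Fin n)) : Prop :=
  (∀ v : Vertex, IsLeaf t v →
    ∃ hb : {x ∈ t | x < v}.ncard - v.length < n,
      ((π ⟨{x ∈ t | x < v}.ncard - v.length, hb⟩ : Fin n) : ℕ)
        = {x ∈ t | x < v}.ncard - 1) ∧
  ∀ a b : Fin n, a < b →
    (∀ v : Vertex, IsLeaf t v → {x ∈ t | x < v}.ncard - v.length ≠ (a : ℕ)) →
    (∀ v : Vertex, IsLeaf t v → {x ∈ t | x < v}.ncard - v.length ≠ (b : ℕ)) →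
    π a < π b

/-- `π` is the permutation `Φ^{123}_t = (n+1) - Φ^{321}_t` of `[n]`. -/
def Is123Image (n : ℕ) (t : Set Vertex) (π : Equiv.Perm (Fin n)) : Prop :=
  ∃ π' : Equiv.Perm (Fin n), Is321Image n t π' ∧ ∀ i : Fin n, π i = Fin.rev (π' i)



section WeakConvergence

/-- The cylinder of all `f` with `f i = a` for every `(i, a) ∈ S`. -/
def cylinder (S : Finset (ℕ × ℕ)) : Set (ℕ → ℕ∞) := {f | ∀ p ∈ S, f p.1 = (p.2 : ℕ∞)}

lemma isClopen_cylinder (S : Finset (ℕ × ℕ)) : IsClopen (cylinder S) := by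
  have h : cylinder S = ⋂ p ∈ S, (fun f : ℕ → ℕ∞ => f p.1) ⁻¹' {(p.2 : ℕ∞)} := by
    ext f; simp [cylinder]
  rw [h]
  refine isClopen_biInter_finset fun p _ => IsClopen.preimage ?_ (continuous_apply p.1)
  exact ⟨isClosed_singleton, ENat.isOpen_singleton (ENat.natCast_ne_top _)⟩

lemma isPiSystem_range_cylinder : IsPiSystem (range cylinder) := by
  classical
  rintro _ ⟨S, rfl⟩ _ ⟨T, rfl⟩ -
  refine ⟨S ∪ T, ?_⟩
  ext f
  simp only [cylinder, Finset.mem_union, mem_inter_iff, mem_ofPred_eq]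
  grind

lemma measurableSpace_eq_generateFrom_cylinder :
    (MeasurableSpace.pi : MeasurableSpace (ℕ → ℕ∞)) =
      MeasurableSpace.generateFrom (range cylinder) := by
  apply le_antisymm
  · refine iSup_le fun i => ?_
    rw [MeasurableSpace.comap_le_iff_le_map]
    have hfin : ∀ a : ℕ, MeasurableSet[MeasurableSpace.generateFrom (range cylinder)]
        ((fun f : ℕ → ℕ∞ => f i) ⁻¹' {(a : ℕ∞)}) := fun a =>
      MeasurableSpace.measurableSet_generateFrom ⟨{(i, a)}, by ext f; simp [cylinder]⟩
    have htop : MeasurableSet[MeasurableSpace.generateFrom (range cylinder)]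
        ((fun f : ℕ → ℕ∞ => f i) ⁻¹' {⊤}) := by
      have : (fun f : ℕ → ℕ∞ => f i) ⁻¹' {⊤} =
          (⋃ a : ℕ, (fun f : ℕ → ℕ∞ => f i) ⁻¹' {(a : ℕ∞)})ᶜ := by
        ext f
        simp only [mem_preimage, mem_singleton_iff, mem_compl_iff, mem_iUnion, not_exists]
        rw [← not_iff_not, not_forall]
        simp only [not_not, eq_comm (a := f i), ← ENat.ne_top_iff_exists, ne_eq]
      rw [this]
      exact (MeasurableSet.iUnion hfin).compl
    intro s _
    change MeasurableSet[MeasurableSpace.generateFrom (range cylinder)]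
      ((fun f : ℕ → ℕ∞ => f i) ⁻¹' s)
    rw [← biUnion_of_singleton s, preimage_iUnion₂]
    refine MeasurableSet.biUnion (to_countable s) fun a _ => ?_
    induction a using ENat.recTopCoe with
    | top => exact htop
    | coe a => exact hfin a
  · refine MeasurableSpace.generateFrom_le ?_
    rintro _ ⟨S, rfl⟩
    exact (isClopen_cylinder S).isOpen.measurableSet

/-- Sequences of laws on `F(ℕ, ℕ*)` whose cylinder probabilities converge are weakly
convergent. -/
lemma exists_tendsto_of_cylinder (P : ℕ → ProbabilityMeasure (ℕ → ℕ∞))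
    (h : ∀ S, ∃ l : ℝ, Tendsto (fun n => (P n : Measure (ℕ → ℕ∞)).real (cylinder S))
      atTop (𝓝 l)) :
    ∃ Q : ProbabilityMeasure (ℕ → ℕ∞), Tendsto P atTop (𝓝 Q) := by
  have : BorelSpace ℕ∞ := ⟨borel_eq_top_of_countable.symm⟩
  have key : ∀ Q : ProbabilityMeasure (ℕ → ℕ∞), MapClusterPt Q atTop P →
      ∀ S l, Tendsto (fun n => (P n : Measure (ℕ → ℕ∞)).real (cylinder S)) atTop (𝓝 l) →
        (Q : Measure (ℕ → ℕ∞)).real (cylinder S) = l := by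
    intro Q hQ S l hl
    obtain ⟨U, hU, hUQ⟩ := mapClusterPt_iff_ultrafilter.1 hQ
    have h1 := ProbabilityMeasure.tendsto_measure_of_null_frontier_of_tendsto hUQ
      (E := cylinder S) (by simp [(isClopen_cylinder S).frontier_eq])
    have h2 := (NNReal.tendsto_coe.2 h1)
    exact tendsto_nhds_unique h2 (hl.mono_left hU)
  obtain ⟨Q, -, hQ⟩ := isCompact_univ.exists_mapClusterPt (f := atTop) (u := P) (by simp)
  refine ⟨Q, le_nhds_of_unique_clusterPt fun R hR => ?_⟩
  apply Subtype.ext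
  change (R : Measure (ℕ → ℕ∞)) = (Q : Measure (ℕ → ℕ∞))
  refine ext_of_generate_finite _ measurableSpace_eq_generateFrom_cylinder
    isPiSystem_range_cylinder ?_ (by simp)
  rintro _ ⟨S, rfl⟩
  obtain ⟨l, hl⟩ := h S
  have := (key R hR S l hl).trans (key Q hQ S l hl).symm
  exact (measureReal_eq_measureReal_iff).1 this

end WeakConvergence

section Catalan

lemma exists_tendsto_of_approx (u : ℕ → ℝ)
    (h : ∀ ε > 0, ∃ (v : ℕ → ℝ) (l : ℝ), Tendsto v atTop (𝓝 l) ∧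
      ∀ᶠ n in atTop, |u n - v n| ≤ ε) :
    ∃ l, Tendsto u atTop (𝓝 l) := by
  apply cauchySeq_tendsto_of_complete
  rw [Metric.cauchySeq_iff']
  intro ε hε
  obtain ⟨v, l, hv, huv⟩ := h (ε / 5) (by positivity)
  have h2 := (Metric.tendsto_nhds.1 hv) (ε / 5) (by positivity)
  obtain ⟨N, hN⟩ := eventually_atTop.1 (huv.and h2)
  refine ⟨N, fun n hn => ?_⟩
  obtain ⟨a1, a2⟩ := hN n hn
  obtain ⟨b1, b2⟩ := hN N le_rfl
  rw [Real.dist_eq, abs_lt] at *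
  rw [abs_le] at *
  constructor <;> linarith

lemma catalan_pos (n : ℕ) : 0 < catalan n := by
  have h := succ_mul_catalan_eq_centralBinom n
  have := Nat.centralBinom_pos n
  exact Nat.pos_of_ne_zero fun h0 => by simp [h0] at h; omega

lemma catalan_succ_mul (n : ℕ) :
    (n + 2 : ℝ) * catalan (n + 1) = 2 * (2 * n + 1) * catalan n := by
  have h1 : ((n + 2 : ℕ) : ℝ) * catalan (n + 1) = Nat.centralBinom (n + 1) := by
    exact_mod_cast succ_mul_catalan_eq_centralBinom (n + 1)
  have h2 : ((n + 1 : ℕ) : ℝ) * catalan n = Nat.centralBinom n := by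
    exact_mod_cast succ_mul_catalan_eq_centralBinom n
  have h3 : ((n + 1 : ℕ) : ℝ) * Nat.centralBinom (n + 1) =
      2 * (2 * n + 1) * Nat.centralBinom n := by
    exact_mod_cast Nat.succ_mul_centralBinom_succ n
  push_cast at *
  have : (n + 1 : ℝ) ≠ 0 := by positivity
  apply mul_left_cancel₀ this
  rw [h1, h3, ← h2]
  ring

lemma catalan_cast_pos (n : ℕ) : (0 : ℝ) < catalan n := by exact_mod_cast catalan_pos n

lemma tendsto_catalan_div_succ :
    Tendsto (fun n : ℕ => (catalan n : ℝ) / catalan (n + 1)) atTop (𝓝 (1 / 4)) := by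
  have h : ∀ n : ℕ, (catalan n : ℝ) / catalan (n + 1) =
      1 / 4 + (3 / 8) / ((n : ℝ) + 1 / 2) := by
    intro n
    have h1 := catalan_succ_mul n
    have h2 := catalan_cast_pos (n + 1)
    have h3 : (0 : ℝ) < (n : ℝ) + 1 / 2 := by positivity
    field_simp
    linarith
  simp_rw [h]
  have : Tendsto (fun n : ℕ => (3 / 8 : ℝ) / ((n : ℝ) + 1 / 2)) atTop (𝓝 0) :=
    (tendsto_atTop_add_const_right _ _ tendsto_natCast_atTop_atTop).const_div_atTop _
  simpa only [add_zero] using this.const_add (1 / 4)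

lemma tendsto_catalan_div_add (k : ℕ) :
    Tendsto (fun n : ℕ => (catalan n : ℝ) / catalan (n + k)) atTop (𝓝 ((1 / 4) ^ k)) := by
  induction k with
  | zero =>
    refine tendsto_const_nhds.congr fun n => ?_
    have := catalan_cast_pos n
    simp [div_self this.ne']
  | succ k ih =>
    rw [pow_succ]
    refine (ih.mul (tendsto_catalan_div_succ.comp (tendsto_add_atTop_nat k))).congr fun n => ?_
    have := catalan_cast_pos (n + k)
    simp only [Function.comp, ← add_assoc]
    field_simp

lemma sum_catalan_div (K : ℕ) :
    ∑ j ∈ Finset.range K, (catalan j : ℝ) * (1 / 4) ^ (j + 1) =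
      (1 - (K + 1) * catalan K * (1 / 4) ^ K) / 2 := by
  induction K with
  | zero => simp
  | succ K ih =>
    rw [Finset.sum_range_succ, ih]
    have h := catalan_succ_mul K
    push_cast
    have h2 : (K + 1 + 1 : ℝ) * catalan (K + 1) = 2 * (2 * K + 1) * catalan K := by
      rw [← h]; ring
    rw [h2, pow_succ]
    ring

lemma tendsto_centralBinom_div :
    Tendsto (fun n : ℕ => ((n : ℝ) + 1) * catalan n * (1 / 4) ^ n) atTop (𝓝 0) := by
  have key : ∀ n : ℕ, (((n : ℝ) + 1) * catalan n * (1 / 4) ^ n) ^ 2 ≤ 1 / (n + 1) := by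
    intro n
    induction n with
    | zero => simp
    | succ n ih =>
      have h := catalan_succ_mul n
      have h2 : ((n + 1 : ℕ) + 1 : ℝ) * catalan (n + 1) * (1 / 4) ^ (n + 1) =
          (2 * n + 1) / (2 * n + 2) * ((n + 1) * catalan n * (1 / 4) ^ n) := by
        push_cast
        rw [show ((n : ℝ) + 1 + 1) = n + 2 by ring, h, pow_succ]
        field_simp
        ring
      rw [h2, mul_pow]
      calc _ ≤ ((2 * n + 1 : ℝ) / (2 * n + 2)) ^ 2 * (1 / (n + 1)) := by gcongr
        _ ≤ _ := by
          push_cast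
          rw [div_pow, div_mul_div_comm, div_le_div_iff₀ (by positivity) (by positivity)]
          have : (0 : ℝ) ≤ n := by positivity
          nlinarith
  have h1 : Tendsto (fun n : ℕ => √(1 / ((n : ℝ) + 1))) atTop (𝓝 0) := by
    simpa [Function.comp_def] using (Real.continuous_sqrt.tendsto 0).comp tendsto_one_div_add_atTop_nhds_zero_nat
  refine squeeze_zero (fun n => by positivity) (fun n => ?_) h1
  exact Real.le_sqrt_of_sq_le (key n)

lemma sum_antidiagonal_eq_head_add_tail (x : ℕ → ℕ → ℝ) {K n : ℕ} (hn : 2 * K ≤ n) :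
    ∑ p ∈ Finset.HasAntidiagonal.antidiagonal n, x p.1 p.2 =
      ∑ j ∈ Finset.range K, x j (n - j) + ∑ m ∈ Finset.range K, x (n - m) m +
        ∑ p ∈ (Finset.HasAntidiagonal.antidiagonal n).filter (fun p => K ≤ p.1 ∧ K ≤ p.2), x p.1 p.2 := by
  have h1 : ∑ j ∈ Finset.range K, x j (n - j) =
      ∑ p ∈ (Finset.HasAntidiagonal.antidiagonal n).filter (fun p => p.1 < K), x p.1 p.2 := by
    apply Finset.sum_nbij' (fun j => (j, n - j)) (fun p => p.1) <;>
      simp +contextual [Prod.ext_iff] <;> omega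
  have h2 : ∑ m ∈ Finset.range K, x (n - m) m =
      ∑ p ∈ (Finset.HasAntidiagonal.antidiagonal n).filter (fun p => ¬ p.1 < K ∧ p.2 < K), x p.1 p.2 := by
    apply Finset.sum_nbij' (fun m => (n - m, m)) (fun p => p.2) <;>
      simp +contextual [Prod.ext_iff] <;> omega
  rw [h1, h2, ← Finset.sum_filter_add_sum_filter_not _ (fun p : ℕ × ℕ => p.1 < K), add_assoc]
  congr 1
  rw [← Finset.sum_filter_add_sum_filter_not _ (fun p : ℕ × ℕ => p.2 < K),
    Finset.filter_filter, Finset.filter_filter]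
  simp only [not_lt]

/-- A dominated convergence theorem for Catalan convolutions: both ends of the convolution
contribute to the limit, and the middle part is negligible. -/
lemma exists_tendsto_sum_antidiagonal (x : ℕ → ℕ → ℝ) (h0 : ∀ j m, 0 ≤ x j m)
    (hx : ∀ j m, x j m ≤ catalan j * catalan m)
    (h1 : ∀ j, ∃ l, Tendsto (fun m => x j m / catalan m) atTop (𝓝 l))
    (h2 : ∀ m, ∃ l, Tendsto (fun j => x j m / catalan j) atTop (𝓝 l)) :
    ∃ l, Tendsto (fun n => (∑ p ∈ Finset.HasAntidiagonal.antidiagonal n, x p.1 p.2) / catalan (n + 1))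
      atTop (𝓝 l) := by
  have shift : ∀ (y : ℕ → ℝ) (l : ℝ) (j : ℕ), Tendsto (fun m => y m / catalan m) atTop (𝓝 l) →
      Tendsto (fun n => y (n - j) / catalan (n + 1)) atTop (𝓝 (l * (1 / 4) ^ (j + 1))) := by
    intro y l j hy
    rw [← tendsto_add_atTop_iff_nat j]
    refine (hy.mul (tendsto_catalan_div_add (j + 1))).congr fun n => ?_
    have := catalan_cast_pos n
    simp only [Nat.add_sub_cancel, ← add_assoc]
    field_simp
  choose a ha using h1
  choose b hb using h2
  apply exists_tendsto_of_approx
  intro ε hε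
  obtain ⟨K, hK⟩ := (tendsto_centralBinom_div.eventually (gt_mem_nhds hε)).exists
  have heads : ∀ (y : ℕ → ℕ → ℝ) (a b : ℕ → ℝ),
      (∀ j, Tendsto (fun m => y j m / catalan m) atTop (𝓝 (a j))) →
      (∀ m, Tendsto (fun j => y j m / catalan j) atTop (𝓝 (b m))) →
      Tendsto (fun n => (∑ j ∈ Finset.range K, y j (n - j) +
        ∑ m ∈ Finset.range K, y (n - m) m) / catalan (n + 1)) atTop
        (𝓝 (∑ j ∈ Finset.range K, a j * (1 / 4) ^ (j + 1) +
          ∑ j ∈ Finset.range K, b j * (1 / 4) ^ (j + 1))) := by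
    intro y a b ha hb
    simp_rw [add_div, Finset.sum_div]
    exact (tendsto_finsetSum _ fun j _ => shift (y j) _ j (ha j)).add
      (tendsto_finsetSum _ fun m _ => shift (fun j => y j m) _ m (hb m))
  refine ⟨_, _, heads x a b ha hb, ?_⟩
  have hc := heads (fun j m => catalan j * catalan m) (fun j => catalan j) (fun j => catalan j)
    (fun j => tendsto_const_nhds.congr fun m => by
      have := catalan_cast_pos m
      field_simp)
    (fun j => tendsto_const_nhds.congr fun m => by
      have := catalan_cast_pos m
      field_simp)
  rw [sum_catalan_div] at hc
  have hlt : 1 - ε < (1 - ((K : ℝ) + 1) * catalan K * (1 / 4) ^ K) / 2 +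
      (1 - ((K : ℝ) + 1) * catalan K * (1 / 4) ^ K) / 2 := by linarith
  have hc2 := hc.eventually (lt_mem_nhds hlt)
  filter_upwards [hc2, eventually_ge_atTop (2 * K)] with n hn hnK
  have hpos := catalan_cast_pos (n + 1)
  rw [lt_div_iff₀ hpos] at hn
  rw [← sub_div, abs_div, abs_of_pos hpos, div_le_iff₀ hpos,
    sum_antidiagonal_eq_head_add_tail x hnK, add_sub_cancel_left]
  have htot := sum_antidiagonal_eq_head_add_tail (fun j m => (catalan j : ℝ) * catalan m) hnK
  have hcat : ∑ p ∈ Finset.HasAntidiagonal.antidiagonal n, (catalan p.1 : ℝ) * catalan p.2 =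
      catalan (n + 1) := by
    rw [catalan_succ']; push_cast; rfl
  rw [abs_of_nonneg (Finset.sum_nonneg fun p _ => h0 _ _)]
  have hle := Finset.sum_le_sum (s := (Finset.HasAntidiagonal.antidiagonal n).filter
    (fun p => K ≤ p.1 ∧ K ≤ p.2)) fun p _ => hx p.1 p.2
  linarith

end Catalan

section Glue

/-- `f i = a` for every `(i, a) ∈ S`. -/
def Satisfies (S : Finset (ℕ × ℕ)) (f : ℕ → ℕ) : Prop := ∀ p ∈ S, f p.1 = p.2

/-- The word consisting of `g 0 + a, …, g (j - 1) + a`, then `0`, then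
`h 0 + b, …, h (m - 1) + b`, padded with zeros. -/
def glue (a b j m : ℕ) (g h : ℕ → ℕ) : ℕ → ℕ := fun k =>
  if k < j then g k + a else if k = j then 0 else if k ≤ j + m then h (k - j - 1) + b else 0

lemma glue_injective {a b j m : ℕ} {g h g' h' : ℕ → ℕ}
    (hg : ∀ k, j ≤ k → g k = 0) (hg' : ∀ k, j ≤ k → g' k = 0)
    (hh : ∀ k, m ≤ k → h k = 0) (hh' : ∀ k, m ≤ k → h' k = 0)
    (e : glue a b j m g h = glue a b j m g' h') : g = g' ∧ h = h' := by
  constructor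
  · funext k
    by_cases hk : k < j
    · simpa [glue, hk] using congrFun e k
    · rw [hg k (by omega), hg' k (by omega)]
  · funext k
    by_cases hk : k < m
    · have := congrFun e (j + 1 + k)
      have h1 : ¬ j + 1 + k < j := by omega
      have h2 : ¬ j + 1 + k = j := by omega
      have h3 : j + 1 + k ≤ j + m := by omega
      have h4 : j + 1 + k - j - 1 = k := by omega
      simpa only [glue, h1, h2, h3, h4, if_true, if_false, add_left_inj] using this
    · rw [hh k (by omega), hh' k (by omega)]

open Classical in
lemma card_filter_glue {K : ℕ → Finset (ℕ → ℕ)} {α β : ℕ → ℕ}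
    (hsupp : ∀ n, ∀ f ∈ K n, ∀ k, n ≤ k → f k = 0)
    (hzero : ∀ n, ∀ f ∈ K (n + 1), ∃! j, j ≤ n ∧ f j = 0)
    (hglue : ∀ j m f, (f ∈ K (j + m + 1) ∧ f j = 0) ↔
      ∃ g ∈ K j, ∃ h ∈ K m, glue (α m) (β j) j m g h = f)
    (P : (ℕ → ℕ) → Prop) (n : ℕ) :
    ((K (n + 1)).filter P).card = ∑ p ∈ Finset.HasAntidiagonal.antidiagonal n,
      ((K p.1 ×ˢ K p.2).filter
        (fun q => P (glue (α p.2) (β p.1) p.1 p.2 q.1 q.2))).card := by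
  have h1 : (K (n + 1)).filter P = (Finset.HasAntidiagonal.antidiagonal n).biUnion
      (fun p => (K (n + 1)).filter (fun f => f p.1 = 0 ∧ P f)) := by
    ext f
    simp only [Finset.mem_filter, Finset.mem_biUnion, Finset.HasAntidiagonal.mem_antidiagonal, Prod.exists]
    constructor
    · rintro ⟨hf, hP⟩
      obtain ⟨j, ⟨hj, hj0⟩, -⟩ := hzero n f hf
      exact ⟨j, n - j, by omega, hf, hj0, hP⟩
    · rintro ⟨j, m, -, hf, -, hP⟩
      exact ⟨hf, hP⟩
  rw [h1, Finset.card_biUnion]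
  · refine Finset.sum_congr rfl ?_
    rintro ⟨j, m⟩ hp
    rw [Finset.HasAntidiagonal.mem_antidiagonal] at hp
    simp only at hp ⊢
    have h2 : (K (n + 1)).filter (fun f => f j = 0 ∧ P f) =
        ((K j ×ˢ K m).filter (fun q => P (glue (α m) (β j) j m q.1 q.2))).image
          (fun q => glue (α m) (β j) j m q.1 q.2) := by
      ext f
      have := hglue j m f
      rw [hp] at this
      simp only [Finset.mem_filter, Finset.mem_image, Finset.mem_product, Prod.exists,
        ← and_assoc, this]
      grind
    rw [h2, Finset.card_image_of_injOn]
    rintro ⟨g, h⟩ hq ⟨g', h'⟩ hq' e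
    simp only [Finset.coe_filter, Finset.mem_product, mem_ofPred_eq] at hq hq'
    obtain ⟨e1, e2⟩ := glue_injective (hsupp _ _ hq.1.1) (hsupp _ _ hq'.1.1)
      (hsupp _ _ hq.1.2) (hsupp _ _ hq'.1.2) e
    rw [e1, e2]
  · rintro ⟨j, m⟩ hp ⟨j', m'⟩ hp' hne
    simp only [Finset.mem_coe,
      Finset.HasAntidiagonal.mem_antidiagonal] at hp hp'
    rw [Function.onFun, Finset.disjoint_left]
    intro f hf hf'
    simp only [Finset.mem_filter] at hf hf'
    have := (hzero n f hf.1).unique ⟨by omega, hf.2.1⟩ ⟨(by omega : j' ≤ n), hf'.2.1⟩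
    apply hne
    ext <;> simp <;> omega

lemma satisfies_glue_right {a b j m : ℕ} {g h : ℕ → ℕ} {S : Finset (ℕ × ℕ)}
    (hm : ∀ p ∈ S, p.1 ≤ j + m) :
    Satisfies S (glue a b j m g h) ↔
      ((∀ p ∈ S, p.1 < j → g p.1 + a = p.2) ∧ (∀ p ∈ S, p.1 = j → p.2 = 0) ∧
        ∀ p ∈ S, j < p.1 → b ≤ p.2) ∧
      Satisfies ((S.filter (j < ·.1)).image (fun p => (p.1 - j - 1, p.2 - b))) h := by
  have key : ∀ p ∈ S, glue a b j m g h p.1 = p.2 ↔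
      ((p.1 < j → g p.1 + a = p.2) ∧ (p.1 = j → p.2 = 0) ∧ (j < p.1 → b ≤ p.2)) ∧
        (j < p.1 → h (p.1 - j - 1) = p.2 - b) := by
    intro p hp
    have := hm p hp
    rcases lt_trichotomy p.1 j with h1 | h1 | h1
    · simp [glue, h1, h1.not_gt, h1.ne]
    · simp [glue, h1, eq_comm]
    · simp only [glue, h1.not_gt, h1.ne', this, h1]
      simp only [if_true, if_false, false_imp_iff, true_and, true_imp_iff]
      omega
  simp only [Satisfies, Finset.forall_mem_image, Finset.mem_filter, and_imp]
  grind

lemma satisfies_glue_left {a b j m : ℕ} {g h : ℕ → ℕ} {S : Finset (ℕ × ℕ)}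
    (hj : ∀ p ∈ S, p.1 < j) :
    Satisfies S (glue a b j m g h) ↔
      (∀ p ∈ S, a ≤ p.2) ∧ Satisfies (S.image (fun p => (p.1, p.2 - a))) g := by
  simp only [Satisfies, Finset.forall_mem_image]
  rw [← forall₂_and]
  refine forall₂_congr fun p hp => ?_
  simp only [glue, hj p hp, if_true]
  omega


open Classical in
lemma card_eq_catalan_of_glue {K : ℕ → Finset (ℕ → ℕ)} {α β : ℕ → ℕ} (h0 : (K 0).card = 1)
    (hsupp : ∀ n, ∀ f ∈ K n, ∀ k, n ≤ k → f k = 0)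
    (hzero : ∀ n, ∀ f ∈ K (n + 1), ∃! j, j ≤ n ∧ f j = 0)
    (hglue : ∀ j m f, (f ∈ K (j + m + 1) ∧ f j = 0) ↔
      ∃ g ∈ K j, ∃ h ∈ K m, glue (α m) (β j) j m g h = f)
    (n : ℕ) : (K n).card = catalan n := by
  induction n using Nat.strong_induction_on with
  | _ n ih =>
    cases n with
    | zero => simpa using h0
    | succ n =>
      have h := card_filter_glue hsupp hzero hglue (fun _ => True) n
      simp only [Finset.filter_true, Finset.card_product] at h
      rw [h, catalan_succ']
      refine Finset.sum_congr rfl fun p hp => ?_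
      rw [Finset.HasAntidiagonal.mem_antidiagonal] at hp
      rw [ih p.1 (by omega), ih p.2 (by omega)]

open Classical in
lemma card_filter_product_eq_sum {ι κ : Type*} (s : Finset ι) (t : Finset κ)
    (P : ι × κ → Prop) :
    ((s ×ˢ t).filter P).card = ∑ a ∈ s, (t.filter fun b => P (a, b)).card := by
  simp only [Finset.card_filter, Finset.sum_product]

open Classical in
/-- If the permutations of a class decompose at the position of their minimum into two
independent permutations of the class, then the probabilities of prescribing finitely many values
converge. -/
lemma exists_tendsto_of_glue {K : ℕ → Finset (ℕ → ℕ)} {α β : ℕ → ℕ} (h0 : (K 0).card = 1)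
    (hsupp : ∀ n, ∀ f ∈ K n, ∀ k, n ≤ k → f k = 0)
    (hzero : ∀ n, ∀ f ∈ K (n + 1), ∃! j, j ≤ n ∧ f j = 0)
    (hglue : ∀ j m f, (f ∈ K (j + m + 1) ∧ f j = 0) ↔
      ∃ g ∈ K j, ∃ h ∈ K m, glue (α m) (β j) j m g h = f)
    (hα : (∀ m, α m = 1) ∨ ∀ m, α m = m + 1) (hβ : ∀ j, 1 ≤ β j) (S : Finset (ℕ × ℕ)) :
    ∃ l, Tendsto (fun n => (((K n).filter (Satisfies S)).card : ℝ) / (K n).card)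
      atTop (𝓝 l) := by
  have hcat := card_eq_catalan_of_glue h0 hsupp hzero hglue
  obtain ⟨M, hM⟩ : ∃ M, ∀ p ∈ S, p.2 < M := by
    obtain ⟨M, hM⟩ := (S.image Prod.snd).exists_nat_subset_range
    exact ⟨M, fun p hp => Finset.mem_range.1 (hM (Finset.mem_image_of_mem _ hp))⟩
  simp_rw [hcat]
  induction M generalizing S with
  | zero =>
    have hS : S = ∅ := Finset.eq_empty_of_forall_notMem fun p hp => by
      have := hM p hp
      omega
    refine ⟨1, tendsto_const_nhds.congr fun n => ?_⟩
    have : (K n).filter (Satisfies S) = K n :=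
      Finset.filter_true_of_mem fun f _ => by simp [Satisfies, hS]
    rw [this, hcat, div_self (catalan_cast_pos n).ne']
  | succ M ih =>
    obtain ⟨B, hB⟩ : ∃ B, ∀ p ∈ S, p.1 < B := by
      obtain ⟨B, hB⟩ := (S.image Prod.fst).exists_nat_subset_range
      exact ⟨B, fun p hp => Finset.mem_range.1 (hB (Finset.mem_image_of_mem _ hp))⟩
    have hmain := exists_tendsto_sum_antidiagonal
      (fun j m => (((K j ×ˢ K m).filter
        (fun q => Satisfies S (glue (α m) (β j) j m q.1 q.2))).card : ℝ))
      (fun j m => by positivity)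
      (fun j m => by
        rw [← hcat, ← hcat, ← Nat.cast_mul, ← Finset.card_product]
        exact_mod_cast Finset.card_filter_le _ _) ?_ ?_
    · obtain ⟨l, hl⟩ := hmain
      refine ⟨l, (tendsto_add_atTop_iff_nat 1).1 (hl.congr fun n => ?_)⟩
      rw [card_filter_glue hsupp hzero hglue, Nat.cast_sum]
    · intro j
      simp_rw [card_filter_product_eq_sum, Nat.cast_sum, Finset.sum_div]
      have hg : ∀ g : ℕ → ℕ, ∃ l, Tendsto (fun m => (((K m).filter
          (fun h => Satisfies S (glue (α m) (β j) j m g h))).card : ℝ) / catalan m)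
          atTop (𝓝 l) := by
        intro g
        obtain ⟨C, hC⟩ : ∃ C : Prop, ∀ᶠ m in atTop,
            ((∀ p ∈ S, p.1 < j → g p.1 + α m = p.2) ↔ C) := by
          rcases hα with hα | hα
          · exact ⟨∀ p ∈ S, p.1 < j → g p.1 + 1 = p.2, by simp [hα]⟩
          · refine ⟨∀ p ∈ S, ¬ p.1 < j, ?_⟩
            filter_upwards [eventually_ge_atTop (M + 1)] with m hm
            refine forall₂_congr fun p hp => ?_
            have := hM p hp
            rw [hα]
            omega
        by_cases hc : C ∧ (∀ p ∈ S, p.1 = j → p.2 = 0) ∧ ∀ p ∈ S, j < p.1 → β j ≤ p.2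
        · obtain ⟨l, hl⟩ := ih
            ((S.filter (j < ·.1)).image (fun p => (p.1 - j - 1, p.2 - β j))) (by
              simp only [Finset.forall_mem_image, Finset.mem_filter]
              intro p hp
              have h1 := hM p hp.1
              have h2 := hc.2.2 p hp.1 hp.2
              have h3 := hβ j
              omega)
          refine ⟨l, hl.congr' ?_⟩
          filter_upwards [hC, eventually_ge_atTop B] with m hm hmB
          congr 3
          refine Finset.filter_congr fun h _ => ?_
          rw [satisfies_glue_right (fun p hp => by have := hB p hp; omega), hm]
          exact (and_iff_right hc).symm
        · refine ⟨0, tendsto_const_nhds.congr' ?_⟩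
          filter_upwards [hC, eventually_ge_atTop B] with m hm hmB
          rw [Finset.filter_false_of_mem]
          · simp
          · intro h _
            rw [satisfies_glue_right (fun p hp => by have := hB p hp; omega), hm]
            exact fun H => hc H.1
      choose l hl using hg
      exact ⟨_, tendsto_finsetSum _ fun g _ => hl g⟩
    · intro m
      by_cases hc : ∀ p ∈ S, α m ≤ p.2
      · obtain ⟨l, hl⟩ := ih (S.image (fun p => (p.1, p.2 - α m))) (by
          simp only [Finset.forall_mem_image]
          intro p hp
          have h1 := hM p hp
          have h2 := hc p hp
          have h3 : 1 ≤ α m := by rcases hα with hα | hα <;> simp [hα]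
          omega)
        refine ⟨l * (K m).card, (hl.mul_const _).congr' ?_⟩
        filter_upwards [eventually_ge_atTop B] with j hj
        rw [div_mul_eq_mul_div, ← Nat.cast_mul, ← Finset.card_product]
        congr 2
        have : ((K j ×ˢ K m).filter (fun q => Satisfies S (glue (α m) (β j) j m q.1 q.2))) =
            (K j).filter (Satisfies (S.image (fun p => (p.1, p.2 - α m)))) ×ˢ K m := by
          ext q
          simp only [Finset.mem_filter, Finset.mem_product,
            satisfies_glue_left (fun p hp => (hB p hp).trans_le hj)]
          grind
        rw [this]
      · refine ⟨0, tendsto_const_nhds.congr' ?_⟩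
        filter_upwards [eventually_ge_atTop B] with j hj
        rw [Finset.filter_false_of_mem]
        · simp
        · intro q _
          rw [satisfies_glue_left (fun p hp => (hB p hp).trans_le hj)]
          exact fun H => hc H.1

end Glue

section Words

/-- The one-line notation of a permutation of `{0, …, n - 1}`, padded with zeros. -/
def wordOf {n : ℕ} (π : Equiv.Perm (Fin n)) : ℕ → ℕ := fun k =>
  if h : k < n then π ⟨k, h⟩ else 0

lemma wordOf_apply {n : ℕ} (π : Equiv.Perm (Fin n)) (k : Fin n) : wordOf π k = π k := by
  simp [wordOf]

lemma wordOf_injective {n : ℕ} :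
    Function.Injective (wordOf : Equiv.Perm (Fin n) → ℕ → ℕ) := by
  intro π ρ h
  ext k
  rw [← wordOf_apply, ← wordOf_apply, h]

/-- The functions of the form `wordOf π`. -/
def IsWord (n : ℕ) (f : ℕ → ℕ) : Prop :=
  (∀ k < n, f k < n) ∧ (∀ i < n, ∀ j < n, f i = f j → i = j) ∧ ∀ k, n ≤ k → f k = 0

lemma isWord_iff {n : ℕ} {f : ℕ → ℕ} :
    IsWord n f ↔ ∃ π : Equiv.Perm (Fin n), wordOf π = f := by
  constructor
  · rintro ⟨h1, h2, h3⟩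
    have hinj : Function.Injective (fun k : Fin n => (⟨f k, h1 k k.2⟩ : Fin n)) := by
      intro i j hij
      exact Fin.ext (h2 i i.2 j j.2 (congrArg Fin.val hij))
    refine ⟨Equiv.ofBijective _ (Finite.injective_iff_bijective.1 hinj), ?_⟩
    funext k
    by_cases hk : k < n
    · simp [wordOf, hk]
    · simp [wordOf, hk, h3 k (not_lt.1 hk)]
  · rintro ⟨π, rfl⟩
    refine ⟨fun k hk => ?_, fun i hi j hj hij => ?_, fun k hk => ?_⟩
    · simp [wordOf, hk]
    · simpa [wordOf, hi, hj, Fin.val_inj] using hij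
    · simp [wordOf, hk.not_gt]

lemma IsWord.exists_eq {n : ℕ} {f : ℕ → ℕ} (hf : IsWord n f) {v : ℕ} (hv : v < n) :
    ∃ k < n, f k = v := by
  obtain ⟨π, rfl⟩ := isWord_iff.1 hf
  exact ⟨π.symm ⟨v, hv⟩, Fin.isLt _, by simp [wordOf_apply]⟩

lemma containsPat_iff {n : ℕ} {π : Equiv.Perm (Fin n)} {σ : Equiv.Perm (Fin 3)} :
    ContainsPat π σ ↔ ∃ i j k : Fin n, i < j ∧ j < k ∧ (σ 0 < σ 1 ↔ π i < π j) ∧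
      (σ 0 < σ 2 ↔ π i < π k) ∧ (σ 1 < σ 2 ↔ π j < π k) := by
  constructor
  · rintro ⟨f, hf, h⟩
    exact ⟨f 0, f 1, f 2, hf (by decide), hf (by decide), h 0 1, h 0 2, h 1 2⟩
  · rintro ⟨i, j, k, hij, hjk, h01, h02, h12⟩
    refine ⟨![i, j, k], ?_, ?_⟩
    · rw [Fin.strictMono_iff_lt_succ]
      intro a
      fin_cases a
      · exact hij
      · exact hjk
    · have swap : ∀ (a b : Fin 3) (x y : Fin n), a ≠ b → x ≠ y → (σ a < σ b ↔ π x < π y) →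
          (σ b < σ a ↔ π y < π x) := by
        intro a b x y hab hxy h
        have h1 : σ a ≠ σ b := σ.injective.ne hab
        have h2 : π x ≠ π y := π.injective.ne hxy
        rw [← not_iff_not, not_lt, not_lt, h1.le_iff_lt, h2.le_iff_lt, h]
      intro a b
      fin_cases a <;> fin_cases b
      · simp
      · exact h01
      · exact h02
      · exact swap 0 1 _ _ (by decide) hij.ne h01
      · simp
      · exact h12
      · exact swap 0 2 _ _ (by decide) (hij.trans hjk).ne h02
      · exact swap 1 2 _ _ (by decide) hjk.ne h12
      · simp

/-- The words of the permutations of `{0, …, n - 1}` avoiding `σ`. -/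
noncomputable def avoidWords (σ : Equiv.Perm (Fin 3)) (n : ℕ) : Finset (ℕ → ℕ) :=
  (avoidFinset σ n).map ⟨wordOf, wordOf_injective⟩

lemma mem_avoidFinset {σ : Equiv.Perm (Fin 3)} {n : ℕ} {π : Equiv.Perm (Fin n)} :
    π ∈ avoidFinset σ n ↔ AvoidsPat π σ := by
  simp [avoidFinset]

lemma mem_avoidWords {σ : Equiv.Perm (Fin 3)} {n : ℕ} {f : ℕ → ℕ} :
    f ∈ avoidWords σ n ↔ IsWord n f ∧ ∀ i j k, i < j → j < k → k < n →
      ¬ ((σ 0 < σ 1 ↔ f i < f j) ∧ (σ 0 < σ 2 ↔ f i < f k) ∧ (σ 1 < σ 2 ↔ f j < f k)) := by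
  have key : ∀ π : Equiv.Perm (Fin n), π ∈ avoidFinset σ n ↔ ∀ i j k, i < j → j < k → k < n →
      ¬ ((σ 0 < σ 1 ↔ wordOf π i < wordOf π j) ∧ (σ 0 < σ 2 ↔ wordOf π i < wordOf π k) ∧
        (σ 1 < σ 2 ↔ wordOf π j < wordOf π k)) := by
    intro π
    have lt_iff : ∀ {i j : ℕ} (hi : i < n) (hj : j < n),
        π ⟨i, hi⟩ < π ⟨j, hj⟩ ↔ wordOf π i < wordOf π j := by
      intro i j hi hj
      simp [wordOf, hi, hj]
    rw [mem_avoidFinset, AvoidsPat, containsPat_iff]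
    constructor
    · intro h i j k hij hjk hk hc
      have hj := hjk.trans hk
      have hi := hij.trans hj
      refine h ⟨⟨i, hi⟩, ⟨j, hj⟩, ⟨k, hk⟩, hij, hjk, ?_⟩
      simpa only [lt_iff] using hc
    · rintro h ⟨⟨i, hi⟩, ⟨j, hj⟩, ⟨k, hk⟩, hij, hjk, hc⟩
      exact h i j k hij hjk hk (by simpa only [lt_iff] using hc)
  rw [isWord_iff, avoidWords, Finset.mem_map]
  constructor
  · rintro ⟨π, hπ, rfl⟩
    exact ⟨⟨π, rfl⟩, (key π).1 hπ⟩
  · rintro ⟨⟨π, rfl⟩, h⟩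
    exact ⟨π, (key π).2 h, rfl⟩

lemma mem_avoidWords_312 {n : ℕ} {f : ℕ → ℕ} :
    f ∈ avoidWords p312 n ↔ IsWord n f ∧ ∀ i j k, i < j → j < k → k < n →
      ¬ (f j < f k ∧ f k < f i) := by
  rw [mem_avoidWords]
  refine and_congr_right fun hf => forall₃_congr fun i j k => forall₃_congr fun hij hjk hk => ?_
  have h0 : p312 0 = 2 := rfl
  have h1 : p312 1 = 0 := rfl
  have h2 : p312 2 = 1 := rfl
  have h3 := hf.2.1 i (by omega) j (by omega)
  have h4 := hf.2.1 i (by omega) k (by omega)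
  simp only [h0, h1, h2, Fin.reduceLT, false_iff, true_iff]
  omega

lemma mem_avoidWords_213 {n : ℕ} {f : ℕ → ℕ} :
    f ∈ avoidWords p213 n ↔ IsWord n f ∧ ∀ i j k, i < j → j < k → k < n →
      ¬ (f j < f i ∧ f i < f k) := by
  rw [mem_avoidWords]
  refine and_congr_right fun hf => forall₃_congr fun i j k => forall₃_congr fun hij hjk hk => ?_
  have h0 : p213 0 = 1 := rfl
  have h1 : p213 1 = 0 := rfl
  have h2 : p213 2 = 2 := rfl
  have h3 := hf.2.1 i (by omega) j (by omega)
  have h4 := hf.2.1 j (by omega) k (by omega)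
  simp only [h0, h1, h2, Fin.reduceLT, false_iff, true_iff]
  omega

lemma mem_avoidWords_321 {n : ℕ} {f : ℕ → ℕ} :
    f ∈ avoidWords p321 n ↔ IsWord n f ∧ ∀ i j k, i < j → j < k → k < n →
      ¬ (f j < f i ∧ f k < f j) := by
  rw [mem_avoidWords]
  refine and_congr_right fun hf => forall₃_congr fun i j k => forall₃_congr fun hij hjk hk => ?_
  have h0 : p321 0 = 2 := rfl
  have h1 : p321 1 = 1 := rfl
  have h2 : p321 2 = 0 := rfl
  have h3 := hf.2.1 i (by omega) j (by omega)
  have h4 := hf.2.1 j (by omega) k (by omega)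
  simp only [h0, h1, h2, Fin.reduceLT, false_iff]
  omega

lemma pattern_cases (σ : Equiv.Perm (Fin 3)) :
    σ = p123 ∨ σ = p132 ∨ σ = p213 ∨ σ = p231 ∨ σ = p312 ∨ σ = p321 := by
  revert σ
  decide

end Words

section Decomposition

lemma glue_left {a b j m k : ℕ} {g h : ℕ → ℕ} (hk : k < j) : glue a b j m g h k = g k + a := by
  simp [glue, hk]

lemma glue_self {a b j m : ℕ} {g h : ℕ → ℕ} : glue a b j m g h j = 0 := by
  simp [glue]

lemma glue_right {a b j m k : ℕ} {g h : ℕ → ℕ} (hk : k < m) :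
    glue a b j m g h (j + 1 + k) = h k + b := by
  have h1 : ¬ j + 1 + k < j := by omega
  have h2 : j + 1 + k ≠ j := by omega
  have h3 : j + 1 + k ≤ j + m := by omega
  have h4 : j + 1 + k - j - 1 = k := by omega
  simp only [glue, h1, h2, h3, h4, if_false, if_true]

lemma glue_of_lt {a b j m k : ℕ} {g h : ℕ → ℕ} (hk : j + m < k) : glue a b j m g h k = 0 := by
  have h1 : ¬ k < j := by omega
  have h2 : k ≠ j := by omega
  simp only [glue, h1, h2, hk.not_ge, if_false]

/-- A position of a glued word is on the left, in the middle, on the right or outside. -/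
lemma glue_cases (j m k : ℕ) : k < j ∨ k = j ∨ (∃ l < m, k = j + 1 + l) ∨ j + m < k := by
  by_cases h : j < k ∧ k ≤ j + m
  · exact Or.inr (Or.inr (Or.inl ⟨k - j - 1, by omega, by omega⟩))
  · omega

lemma IsWord.glue {a b j m : ℕ} {g h : ℕ → ℕ} (hg : IsWord j g) (hh : IsWord m h)
    (hab : a = 1 ∧ b = j + 1 ∨ a = m + 1 ∧ b = 1) :
    IsWord (j + m + 1) (glue a b j m g h) := by
  refine ⟨fun k hk => ?_, fun k hk l hl hkl => ?_, fun k hk => glue_of_lt hk⟩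
  · rcases glue_cases j m k with h1 | h1 | ⟨i, hi, rfl⟩ | h1
    · have := hg.1 k h1
      rw [glue_left h1]
      omega
    · simp [h1, glue_self]
    · have := hh.1 i hi
      rw [glue_right hi]
      omega
    · omega
  · rcases glue_cases j m k with h1 | h1 | ⟨i, hi, rfl⟩ | h1 <;>
      rcases glue_cases j m l with h2 | h2 | ⟨i', hi', rfl⟩ | h2 <;>
      try omega
    all_goals simp only [glue_left, glue_self, glue_right, *] at hkl
    all_goals try omega
    · exact hg.2.1 k h1 l h2 (by omega)
    · have := hg.1 k h1
      have := hh.1 i' hi'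
      omega
    · have := hg.1 l h2
      have := hh.1 i hi
      omega
    · rw [hh.2.1 i hi i' hi' (by omega)]

lemma IsWord.exists_glue {a b j m : ℕ} {f : ℕ → ℕ} (hf : IsWord (j + m + 1) f) (hfj : f j = 0)
    (hl : ∀ k < j, a ≤ f k ∧ f k < a + j)
    (hr : ∀ k < m, b ≤ f (j + 1 + k) ∧ f (j + 1 + k) < b + m) :
    ∃ g h, IsWord j g ∧ IsWord m h ∧ AvoidPaper.glue a b j m g h = f := by
  refine ⟨fun k => if k < j then f k - a else 0, fun k => if k < m then f (j + 1 + k) - b else 0,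
    ⟨fun k hk => ?_, fun i hi k hk hik => ?_, fun k hk => if_neg hk.not_gt⟩,
    ⟨fun k hk => ?_, fun i hi k hk hik => ?_, fun k hk => if_neg hk.not_gt⟩, ?_⟩
  · have := hl k hk
    simp only [hk, if_true]
    omega
  · have h1 := hl i hi
    have h2 := hl k hk
    simp only [hi, hk, if_true] at hik
    exact hf.2.1 i (by omega) k (by omega) (by omega)
  · have := hr k hk
    simp only [hk, if_true]
    omega
  · have h1 := hr i hi
    have h2 := hr k hk
    simp only [hi, hk, if_true] at hik
    have := hf.2.1 (j + 1 + i) (by omega) (j + 1 + k) (by omega) (by omega)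
    omega
  · funext k
    rcases glue_cases j m k with h1 | h1 | ⟨i, hi, rfl⟩ | h1
    · have := hl k h1
      simp only [glue_left h1, h1, if_true]
      omega
    · rw [h1, glue_self, hfj]
    · have := hr i hi
      simp only [glue_right hi, hi, if_true]
      omega
    · rw [glue_of_lt h1, hf.2.2 k h1]

lemma IsWord.card_le {n : ℕ} {f : ℕ → ℕ} (hf : IsWord n f) {s t : Finset ℕ}
    (hs : ∀ k ∈ s, k < n) (hst : ∀ k ∈ s, f k ∈ t) : s.card ≤ t.card :=
  Finset.card_le_card_of_injOn f hst fun i hi k hk => hf.2.1 i (hs i hi) k (hs k hk)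

lemma IsWord.existsUnique_zero {n : ℕ} {f : ℕ → ℕ} (hf : IsWord (n + 1) f) :
    ∃! j, j ≤ n ∧ f j = 0 := by
  obtain ⟨j, hj, h⟩ := hf.exists_eq n.succ_pos
  exact ⟨j, ⟨by omega, h⟩, fun i hi => hf.2.1 i (by omega) j hj (by rw [h, hi.2])⟩

lemma card_avoidWords_zero (σ : Equiv.Perm (Fin 3)) : (avoidWords σ 0).card = 1 := by
  rw [Finset.card_eq_one]
  refine ⟨0, Finset.ext fun f => ?_⟩
  rw [mem_avoidWords, Finset.mem_singleton]
  constructor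
  · rintro ⟨h, -⟩
    exact funext fun k => h.2.2 k (Nat.zero_le k)
  · rintro rfl
    exact ⟨⟨by simp, by simp, by simp⟩, by simp⟩

lemma isWord_of_mem_avoidWords {σ : Equiv.Perm (Fin 3)} {n : ℕ} {f : ℕ → ℕ}
    (hf : f ∈ avoidWords σ n) : IsWord n f := (mem_avoidWords.1 hf).1

lemma glue_mem_avoidWords_312 (j m : ℕ) (f : ℕ → ℕ) :
    (f ∈ avoidWords p312 (j + m + 1) ∧ f j = 0) ↔
      ∃ g ∈ avoidWords p312 j, ∃ h ∈ avoidWords p312 m, glue 1 (j + 1) j m g h = f := by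
  simp only [mem_avoidWords_312]
  constructor
  · rintro ⟨⟨hf, hav⟩, hfj⟩
    have hpos : ∀ k < j + m + 1, k ≠ j → 0 < f k := by
      intro k hk hkj
      by_contra h
      exact hkj (hf.2.1 k hk j (by omega) (by omega))
    have hsep : ∀ k l, k < j → j < l → l ≤ j + m → f k < f l := by
      intro k l hk hl hlm
      have h1 := hav k j l hk hl (by omega)
      have h2 := hpos l (by omega) (by omega)
      have h3 := hf.2.1 k (by omega) l (by omega)
      omega
    obtain ⟨g, h, hg, hh, rfl⟩ := hf.exists_glue hfj (a := 1) (b := j + 1)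
      (fun k hk => by
        have h1 := hpos k (by omega) (by omega)
        have h2 := hf.card_le (s := Finset.Ioc j (j + m)) (t := Finset.Ioc (f k) (j + m))
          (fun l hl => by simp only [Finset.mem_Ioc] at hl; omega)
          (fun l hl => by
            simp only [Finset.mem_Ioc] at hl ⊢
            have h3 := hsep k l hk hl.1 hl.2
            have h4 := hf.1 l (by omega)
            omega)
        have h3 := hf.1 k (by omega)
        simp only [Nat.card_Ioc] at h2
        omega)
      (fun k hk => by
        have h1 := hf.1 (j + 1 + k) (by omega)
        have h2 := hf.card_le (s := Finset.range (j + 1)) (t := Finset.range (f (j + 1 + k)))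
          (fun l hl => by simp only [Finset.mem_range] at hl; omega)
          (fun l hl => by
            simp only [Finset.mem_range] at hl ⊢
            rcases Nat.lt_succ_iff_lt_or_eq.1 hl with h3 | rfl
            · exact hsep l _ h3 (by omega) (by omega)
            · have := hpos (l + 1 + k) (by omega) (by omega)
              omega)
        simp only [Finset.card_range] at h2
        omega)
    refine ⟨g, ⟨hg, fun x y z hxy hyz hz => ?_⟩, h, ⟨hh, fun x y z hxy hyz hz => ?_⟩, rfl⟩
    · have := hav x y z hxy hyz (by omega)
      rw [glue_left hz, glue_left (hyz.trans hz), glue_left (hxy.trans (hyz.trans hz))] at this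
      omega
    · have := hav (j + 1 + x) (j + 1 + y) (j + 1 + z) (by omega) (by omega) (by omega)
      rw [glue_right hz, glue_right (hyz.trans hz), glue_right (hxy.trans (hyz.trans hz))] at this
      omega
  · rintro ⟨g, ⟨hg, hga⟩, h, ⟨hh, hha⟩, rfl⟩
    refine ⟨⟨hg.glue hh (Or.inl ⟨rfl, rfl⟩), fun x y z hxy hyz hz => ?_⟩, glue_self⟩
    rcases glue_cases j m x with h1 | h1 | ⟨i, hi, rfl⟩ | h1 <;>
      rcases glue_cases j m y with h2 | h2 | ⟨i', hi', rfl⟩ | h2 <;>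
      rcases glue_cases j m z with h3 | h3 | ⟨i'', hi'', rfl⟩ | h3 <;>
      try omega
    all_goals simp only [glue_left, glue_self, glue_right, *]
    all_goals try omega
    · have := hga x y z hxy hyz h3
      omega
    · have := hg.1 x h1
      omega
    · have := hg.1 x h1
      omega
    · have := hg.1 x h1
      omega
    · have := hha i i' i'' (by omega) (by omega) hi''
      omega

lemma glue_mem_avoidWords_213 (j m : ℕ) (f : ℕ → ℕ) :
    (f ∈ avoidWords p213 (j + m + 1) ∧ f j = 0) ↔
      ∃ g ∈ avoidWords p213 j, ∃ h ∈ avoidWords p213 m, glue (m + 1) 1 j m g h = f := by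
  simp only [mem_avoidWords_213]
  constructor
  · rintro ⟨⟨hf, hav⟩, hfj⟩
    have hpos : ∀ k < j + m + 1, k ≠ j → 0 < f k := by
      intro k hk hkj
      by_contra h
      exact hkj (hf.2.1 k hk j (by omega) (by omega))
    have hsep : ∀ k l, k < j → j < l → l ≤ j + m → f l < f k := by
      intro k l hk hl hlm
      have h1 := hav k j l hk hl (by omega)
      have h2 := hpos k (by omega) (by omega)
      have h3 := hf.2.1 k (by omega) l (by omega)
      omega
    obtain ⟨g, h, hg, hh, rfl⟩ := hf.exists_glue hfj (a := m + 1) (b := 1)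
      (fun k hk => by
        have h1 := hf.1 k (by omega)
        have h2 := hf.card_le (s := Finset.Icc j (j + m)) (t := Finset.range (f k))
          (fun l hl => by simp only [Finset.mem_Icc] at hl; omega)
          (fun l hl => by
            simp only [Finset.mem_Icc, Finset.mem_range] at hl ⊢
            rcases hl.1.lt_or_eq with h3 | rfl
            · exact hsep k l hk h3 hl.2
            · have := hpos k (by omega) (by omega)
              omega)
        simp only [Nat.card_Icc, Finset.card_range] at h2
        omega)
      (fun k hk => by
        have h1 := hpos (j + 1 + k) (by omega) (by omega)
        have h2 := hf.card_le (s := Finset.range j)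
          (t := Finset.Ioc (f (j + 1 + k)) (j + m))
          (fun l hl => by simp only [Finset.mem_range] at hl; omega)
          (fun l hl => by
            simp only [Finset.mem_range, Finset.mem_Ioc] at hl ⊢
            have h3 := hsep l (j + 1 + k) hl (by omega) (by omega)
            have h4 := hf.1 l (by omega)
            omega)
        have h3 := hf.1 (j + 1 + k) (by omega)
        simp only [Nat.card_Ioc, Finset.card_range] at h2
        omega)
    refine ⟨g, ⟨hg, fun x y z hxy hyz hz => ?_⟩, h, ⟨hh, fun x y z hxy hyz hz => ?_⟩, rfl⟩
    · have := hav x y z hxy hyz (by omega)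
      rw [glue_left hz, glue_left (hyz.trans hz), glue_left (hxy.trans (hyz.trans hz))] at this
      omega
    · have := hav (j + 1 + x) (j + 1 + y) (j + 1 + z) (by omega) (by omega) (by omega)
      rw [glue_right hz, glue_right (hyz.trans hz), glue_right (hxy.trans (hyz.trans hz))] at this
      omega
  · rintro ⟨g, ⟨hg, hga⟩, h, ⟨hh, hha⟩, rfl⟩
    refine ⟨⟨hg.glue hh (Or.inr ⟨rfl, rfl⟩), fun x y z hxy hyz hz => ?_⟩, glue_self⟩
    rcases glue_cases j m x with h1 | h1 | ⟨i, hi, rfl⟩ | h1 <;>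
      rcases glue_cases j m y with h2 | h2 | ⟨i', hi', rfl⟩ | h2 <;>
      rcases glue_cases j m z with h3 | h3 | ⟨i'', hi'', rfl⟩ | h3 <;>
      try omega
    all_goals simp only [glue_left, glue_self, glue_right, *]
    all_goals try omega
    · have := hga x y z hxy hyz h3
      omega
    · have := hh.1 i'' hi''
      omega
    · have := hh.1 i'' hi''
      omega
    · have := hh.1 i'' hi''
      omega
    · have := hha i i' i'' (by omega) (by omega) hi''
      omega

open Classical in
/-- The probabilities that a uniform `σ`-avoiding permutation of `{0, …, n - 1}` takes finitely
many prescribed values converge as `n → ∞`. -/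
def Converges (σ : Equiv.Perm (Fin 3)) : Prop :=
  ∀ S : Finset (ℕ × ℕ), ∃ l : ℝ, Tendsto (fun n =>
    (((avoidWords σ n).filter (Satisfies S)).card : ℝ) / (avoidWords σ n).card) atTop (𝓝 l)

lemma converges_312 : Converges p312 := fun S =>
  exists_tendsto_of_glue (α := fun _ => 1) (β := fun j => j + 1) (card_avoidWords_zero _)
    (fun _ _ hf => (isWord_of_mem_avoidWords hf).2.2)
    (fun _ _ hf => (isWord_of_mem_avoidWords hf).existsUnique_zero)
    glue_mem_avoidWords_312 (Or.inl fun _ => rfl) (fun _ => by simp) S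

lemma converges_213 : Converges p213 := fun S =>
  exists_tendsto_of_glue (α := fun m => m + 1) (β := fun _ => 1) (card_avoidWords_zero _)
    (fun _ _ hf => (isWord_of_mem_avoidWords hf).2.2)
    (fun _ _ hf => (isWord_of_mem_avoidWords hf).existsUnique_zero)
    glue_mem_avoidWords_213 (Or.inr fun _ => rfl) (fun _ => by simp) S

lemma card_avoidWords_312 (n : ℕ) : (avoidWords p312 n).card = catalan n :=
  card_eq_catalan_of_glue (α := fun _ => 1) (β := fun j => j + 1) (card_avoidWords_zero _)
    (fun _ _ hf => (isWord_of_mem_avoidWords hf).2.2)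
    (fun _ _ hf => (isWord_of_mem_avoidWords hf).existsUnique_zero)
    glue_mem_avoidWords_312 n

end Decomposition

section FirstValue

/-- Prepend the value `a` to the word `f` of length `n`, shifting the values at least `a` up. -/
def prepend (n a : ℕ) (f : ℕ → ℕ) : ℕ → ℕ
  | 0 => a
  | k + 1 => if k < n then (if f k < a then f k else f k + 1) else 0

lemma prepend_succ {n a k : ℕ} {f : ℕ → ℕ} (hk : k < n) :
    prepend n a f (k + 1) = if f k < a then f k else f k + 1 := by
  simp [prepend, hk]

lemma IsWord.prepend {n a : ℕ} {f : ℕ → ℕ} (hf : IsWord n f) (ha : a ≤ n) :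
    IsWord (n + 1) (prepend n a f) := by
  refine ⟨fun k hk => ?_, fun i hi k hk hik => ?_, fun k hk => ?_⟩
  · cases k with
    | zero => exact Nat.lt_succ_of_le ha
    | succ k =>
      have := hf.1 k (by omega)
      rw [prepend_succ (by omega)]
      split_ifs <;> omega
  · cases i with
    | zero =>
      cases k with
      | zero => rfl
      | succ k =>
        rw [prepend_succ (by omega)] at hik
        simp only [AvoidPaper.prepend] at hik
        split_ifs at hik <;> omega
    | succ i =>
      cases k with
      | zero =>
        rw [prepend_succ (by omega)] at hik
        simp only [AvoidPaper.prepend] at hik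
        split_ifs at hik <;> omega
      | succ k =>
        rw [prepend_succ (by omega), prepend_succ (by omega)] at hik
        have := hf.2.1 i (by omega) k (by omega)
        split_ifs at hik <;> omega
  · cases k with
    | zero => omega
    | succ k =>
      simp only [AvoidPaper.prepend]
      exact if_neg (by omega)

lemma IsWord.exists_prepend {n : ℕ} {f : ℕ → ℕ} (hf : IsWord (n + 1) f) :
    ∃ g, IsWord n g ∧ AvoidPaper.prepend n (f 0) g = f := by
  have hne : ∀ k < n, f (k + 1) ≠ f 0 := by
    intro k hk h
    have := hf.2.1 (k + 1) (by omega) 0 (by omega) h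
    omega
  have h0 := hf.1 0 (by omega)
  refine ⟨fun k => if k < n then (if f (k + 1) < f 0 then f (k + 1) else f (k + 1) - 1) else 0,
    ⟨fun k hk => ?_, fun i hi k hk hik => ?_, fun k hk => if_neg hk.not_gt⟩, funext fun k => ?_⟩
  · have := hne k hk
    have := hf.1 (k + 1) (by omega)
    simp only [hk, if_true]
    split_ifs <;> omega
  · have := hne i hi
    have := hne k hk
    have := hf.2.1 (i + 1) (by omega) (k + 1) (by omega)
    simp only [hi, hk, if_true] at hik
    split_ifs at hik <;> omega
  · cases k with
    | zero => rfl
    | succ k =>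
      by_cases hk : k < n
      · have := hne k hk
        rw [prepend_succ hk]
        simp only [hk, if_true]
        split_ifs <;> omega
      · simp [AvoidPaper.prepend, hk, hf.2.2 (k + 1) (by omega)]

lemma prepend_injective {n a : ℕ} {f g : ℕ → ℕ} (hf : IsWord n f) (hg : IsWord n g)
    (h : prepend n a f = prepend n a g) : f = g := by
  funext k
  by_cases hk : k < n
  · have := congrFun h (k + 1)
    rw [prepend_succ hk, prepend_succ hk] at this
    split_ifs at this <;> omega
  · rw [hf.2.2 k (by omega), hg.2.2 k (by omega)]

open Classical in
/-- The words of the `321`-avoiding permutations of `{0, …, n - 1}` in which the values less than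
`d` appear in increasing order. -/
noncomputable def incWords (n d : ℕ) : Finset (ℕ → ℕ) :=
  (avoidWords p321 n).filter fun f => ∀ i j, i < j → j < n → f i < d → f i < f j

lemma mem_incWords {n d : ℕ} {f : ℕ → ℕ} : f ∈ incWords n d ↔ IsWord n f ∧
    (∀ i j k, i < j → j < k → k < n → ¬ (f j < f i ∧ f k < f j)) ∧
    ∀ i j, i < j → j < n → f i < d → f i < f j := by
  simp only [incWords, Finset.mem_filter, mem_avoidWords_321, and_assoc]

lemma incWords_zero_right (n : ℕ) : incWords n 0 = avoidWords p321 n := by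
  simp [incWords]

lemma mem_incWords_succ {n d e a : ℕ} (ha : a ≤ n) (h : d ≤ a ∧ e = a ∨ a = 0 ∧ d = e + 1)
    {f : ℕ → ℕ} :
    (f ∈ incWords (n + 1) d ∧ f 0 = a) ↔ ∃ g ∈ incWords n e, prepend n a g = f := by
  simp only [mem_incWords]
  constructor
  · rintro ⟨⟨hf, hav, hinc⟩, rfl⟩
    obtain ⟨g, hg, hgf⟩ := hf.exists_prepend
    have hs : ∀ k < n, f (k + 1) = if g k < f 0 then g k else g k + 1 := fun k hk => by
      rw [← prepend_succ hk, hgf]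
    refine ⟨g, ⟨hg, fun x y z hxy hyz hz => ?_, fun x y hxy hy hx => ?_⟩, hgf⟩
    · have h1 := hav (x + 1) (y + 1) (z + 1) (by omega) (by omega) (by omega)
      rw [hs x (by omega), hs y (by omega), hs z (by omega)] at h1
      split_ifs at h1 <;> omega
    · have h1 := hav 0 (x + 1) (y + 1) (by omega) (by omega) (by omega)
      have h2 := hinc (x + 1) (y + 1) (by omega) (by omega)
      have h3 := hg.2.1 x (by omega) y (by omega)
      rw [hs x (by omega), hs y (by omega)] at h1 h2
      split_ifs at h1 h2 <;> omega
  · rintro ⟨g, ⟨hg, hga, hgi⟩, rfl⟩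
    refine ⟨⟨hg.prepend ha, fun x y z hxy hyz hz => ?_, fun x y hxy hy hx => ?_⟩, rfl⟩
    · obtain ⟨y, rfl⟩ := Nat.exists_eq_add_of_lt (Nat.zero_lt_of_lt hxy)
      obtain ⟨z, rfl⟩ := Nat.exists_eq_add_of_lt (Nat.zero_lt_of_lt hyz)
      simp only [zero_add] at *
      rw [prepend_succ (by omega), prepend_succ (by omega)]
      cases x with
      | zero =>
        have h1 := hgi y z (by omega) (by omega)
        simp only [prepend]
        split_ifs <;> omega
      | succ x =>
        have h1 := hga x y z (by omega) (by omega) (by omega)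
        rw [prepend_succ (by omega)]
        split_ifs <;> omega
    · obtain ⟨y, rfl⟩ := Nat.exists_eq_add_of_lt (Nat.zero_lt_of_lt hxy)
      simp only [zero_add] at *
      rw [prepend_succ (by omega)]
      cases x with
      | zero =>
        simp only [prepend] at hx ⊢
        split_ifs <;> omega
      | succ x =>
        have h1 := hgi x y (by omega) (by omega)
        rw [prepend_succ (by omega)] at hx ⊢
        split_ifs at hx ⊢ <;> omega

open Classical in
lemma card_filter_prepend {n d e a : ℕ} (ha : a ≤ n)
    (h : d ≤ a ∧ e = a ∨ a = 0 ∧ d = e + 1) (P : (ℕ → ℕ) → Prop) :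
    (((incWords (n + 1) d).filter P).filter (fun f => f 0 = a)).card =
      ((incWords n e).filter fun g => P (prepend n a g)).card := by
  symm
  refine Finset.card_bij' (fun g _ => prepend n a g)
    (fun f _ => if h : ∃ g ∈ incWords n e, prepend n a g = f then h.choose else 0) ?_ ?_ ?_ ?_
  · intro g hg
    rw [Finset.mem_filter] at hg
    have := (mem_incWords_succ ha h).2 ⟨g, hg.1, rfl⟩
    simp only [Finset.mem_filter]
    exact ⟨⟨this.1, hg.2⟩, this.2⟩
  · intro f hf
    simp only [Finset.mem_filter] at hf
    have hex := (mem_incWords_succ ha h).1 ⟨hf.1.1, hf.2⟩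
    rw [dif_pos hex, Finset.mem_filter, hex.choose_spec.2]
    exact ⟨hex.choose_spec.1, hf.1.2⟩
  · intro g hg
    have hg' := (Finset.mem_filter.1 hg).1
    have hex : ∃ g' ∈ incWords n e, prepend n a g' = prepend n a g := ⟨g, hg', rfl⟩
    rw [dif_pos hex]
    exact prepend_injective (mem_incWords.1 hex.choose_spec.1).1 (mem_incWords.1 hg').1
      hex.choose_spec.2
  · intro f hf
    simp only [Finset.mem_filter] at hf
    have hex := (mem_incWords_succ ha h).1 ⟨hf.1.1, hf.2⟩
    rw [dif_pos hex]
    exact hex.choose_spec.2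

open Classical in
lemma card_filter_incWords_succ (n d : ℕ) (P : (ℕ → ℕ) → Prop) :
    ((incWords (n + 1) d).filter P).card =
      (if d = 0 then 0 else ((incWords n (d - 1)).filter fun g => P (prepend n 0 g)).card) +
      ∑ a ∈ Finset.Ico d (n + 1), ((incWords n a).filter fun g => P (prepend n a g)).card := by
  rw [Finset.card_eq_sum_card_fiberwise (f := fun f => f 0) (t := Finset.range (n + 1))
    (fun f hf => by
      rw [Finset.mem_coe, Finset.mem_filter, mem_incWords] at hf
      exact Finset.mem_coe.2 (Finset.mem_range.2 (hf.1.1.1 0 (by omega))))]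
  have hsum : ∑ a ∈ Finset.Ico d (n + 1),
      (((incWords (n + 1) d).filter P).filter (fun f => f 0 = a)).card =
      ∑ a ∈ Finset.Ico d (n + 1), ((incWords n a).filter fun g => P (prepend n a g)).card := by
    refine Finset.sum_congr rfl fun a ha => ?_
    rw [Finset.mem_Ico] at ha
    exact card_filter_prepend (by omega) (Or.inl ⟨ha.1, rfl⟩) P
  rw [← hsum]
  split_ifs with hd
  · subst hd
    simp
  · have hd' : d = d - 1 + 1 := by omega
    rw [← card_filter_prepend (n := n) (d := d) (Nat.zero_le n) (Or.inr ⟨rfl, hd'⟩) P]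
    rw [← Finset.sum_singleton
      (fun a => (((incWords (n + 1) d).filter P).filter (fun f => f 0 = a)).card) 0,
      ← Finset.sum_union (by simp [hd])]
    symm
    refine Finset.sum_subset ?_ fun a ha ha' => ?_
    · intro a ha
      simp only [Finset.mem_union, Finset.mem_singleton, Finset.mem_Ico, Finset.mem_range] at *
      omega
    · rw [Finset.card_eq_zero, Finset.filter_eq_empty_iff]
      intro f hf hfa
      simp only [Finset.mem_union, Finset.mem_singleton, Finset.mem_Ico, Finset.mem_range,
        Finset.mem_filter, mem_incWords] at *
      obtain ⟨k, hk, h0⟩ := hf.1.1.exists_eq (Nat.succ_pos n)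
      rcases Nat.eq_zero_or_pos k with rfl | hk0
      · omega
      · have := hf.1.2.2 0 k hk0 hk
        omega

lemma card_incWords_succ (n d : ℕ) :
    (incWords (n + 1) d).card = (if d = 0 then 0 else (incWords n (d - 1)).card) +
      ∑ a ∈ Finset.Ico d (n + 1), (incWords n a).card := by
  simpa using card_filter_incWords_succ n d fun _ => True

lemma card_incWords_of_le {n d : ℕ} (h : n ≤ d) : (incWords n d).card = 1 := by
  induction n generalizing d with
  | zero =>
    have : incWords 0 d = avoidWords p321 0 := by simp [incWords]
    rw [this, card_avoidWords_zero]
  | succ n ih =>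
    rw [card_incWords_succ, if_neg (by omega), ih (by omega), Finset.Ico_eq_empty (by omega),
      Finset.sum_empty, add_zero]

lemma card_incWords_succ_eq {n d : ℕ} (h : d ≤ n) : (incWords (n + 1) d).card =
    (incWords (n + 1) (d + 1)).card + if d = 0 then 0 else (incWords n (d - 1)).card := by
  rw [card_incWords_succ, card_incWords_succ n (d + 1),
    Finset.sum_eq_sum_Ico_succ_bot (show d < n + 1 by omega), if_neg d.succ_ne_zero,
    Nat.add_sub_cancel]
  omega

/-- The ballot numbers. -/
lemma card_incWords {n d : ℕ} (h : d ≤ n) :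
    (incWords n d).card + (2 * n - d).choose (n + 1) = (2 * n - d).choose n := by
  induction n generalizing d with
  | zero =>
    obtain rfl : d = 0 := by omega
    simp [card_incWords_of_le]
  | succ n ih =>
    induction h using Nat.decreasingInduction with
    | self =>
      rw [card_incWords_of_le le_rfl, show 2 * (n + 1) - (n + 1) = n + 1 by omega]
      simp
    | of_succ d hd ihd =>
      rw [card_incWords_succ_eq (Nat.le_of_lt_succ hd)]
      have h1 : 2 * (n + 1) - d = (2 * (n + 1) - (d + 1)) + 1 := by omega
      rw [h1, Nat.choose_succ_succ' _ (n + 1), Nat.choose_succ_succ' _ n]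
      rcases Nat.eq_zero_or_pos d with rfl | hd0
      · have h2 : 2 * (n + 1) - (0 + 1) = 2 * n + 1 := by omega
        have h3 := Nat.choose_symm_half n
        rw [h2] at ihd ⊢
        simp only [if_true]
        omega
      · have h2 := ih (d := d - 1) (by omega)
        have h3 : 2 * n - (d - 1) = 2 * (n + 1) - (d + 1) := by omega
        rw [h3] at h2
        rw [if_neg (by omega)]
        omega

lemma card_avoidWords_321 (n : ℕ) : (avoidWords p321 n).card = catalan n := by
  have h1 := card_incWords (Nat.zero_le n)
  rw [incWords_zero_right, Nat.sub_zero] at h1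
  have h2 := Nat.choose_succ_right_eq (2 * n) n
  have h3 := succ_mul_catalan_eq_centralBinom n
  rw [Nat.centralBinom_eq_two_mul_choose] at h3
  rw [show 2 * n - n = n by omega] at h2
  refine Nat.eq_of_mul_eq_mul_left n.succ_pos ?_
  rw [Nat.succ_eq_add_one, h3]
  nlinarith

lemma tendsto_card_incWords (d : ℕ) :
    Tendsto (fun n => ((incWords n d).card : ℝ) / catalan n) atTop
      (𝓝 ((d + 1 : ℝ) / 2 ^ d)) := by
  have h0 : Tendsto (fun n => ((incWords n 0).card : ℝ) / catalan n) atTop (𝓝 1) := by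
    refine tendsto_const_nhds.congr fun n => ?_
    rw [incWords_zero_right, card_avoidWords_321, div_self (catalan_cast_pos n).ne']
  induction d using Nat.strong_induction_on with
  | _ d ih =>
    match d with
    | 0 => simpa using h0
    | 1 =>
      norm_num
      rw [← tendsto_add_atTop_iff_nat 1]
      refine (h0.comp (tendsto_add_atTop_nat 1)).congr fun n => ?_
      simp [card_incWords_succ_eq (Nat.zero_le n)]
    | d + 2 =>
      rw [← tendsto_add_atTop_iff_nat 1]
      have h1 := (tendsto_add_atTop_iff_nat 1).2 (ih (d + 1) (by omega))
      have h2 := (ih d (by omega)).mul tendsto_catalan_div_succ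
      have h3 := h1.sub h2
      have h4 : ((d + 1 : ℕ) + 1 : ℝ) / 2 ^ (d + 1) - (d + 1 : ℝ) / 2 ^ d * (1 / 4) =
          ((d + 2 : ℕ) + 1 : ℝ) / 2 ^ (d + 2) := by
        push_cast
        field_simp
        ring
      rw [h4] at h3
      refine h3.congr' ?_
      filter_upwards [eventually_ge_atTop (d + 1)] with n hn
      have h5 := card_incWords_succ_eq hn
      rw [if_neg d.succ_ne_zero, Nat.add_sub_cancel] at h5
      have h6 := catalan_cast_pos n
      have h7 := catalan_cast_pos (n + 1)
      rw [h5]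
      push_cast
      field_simp
      ring

lemma satisfies_prepend {n a : ℕ} {g : ℕ → ℕ} {S : Finset (ℕ × ℕ)} (hS : ∀ p ∈ S, p.1 < n) :
    Satisfies S (prepend n a g) ↔
      ((∀ p ∈ S, p.1 = 0 → p.2 = a) ∧ ∀ p ∈ S, 0 < p.1 → p.2 ≠ a) ∧
      Satisfies ((S.filter (0 < ·.1)).image
        fun p => (p.1 - 1, if p.2 < a then p.2 else p.2 - 1)) g := by
  simp only [Satisfies, Finset.forall_mem_image, Finset.mem_filter, ← forall_and, and_imp]
  refine forall₂_congr fun p hp => ?_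
  have hpn := hS p hp
  obtain ⟨k, v⟩ := p
  cases k with
  | zero => simp [prepend, eq_comm]
  | succ k =>
    simp only at hpn
    simp only [prepend_succ (show k < n by omega), Nat.add_sub_cancel]
    simp only [k.succ_ne_zero, k.succ_pos, false_implies, true_implies, true_and]
    split_ifs <;> omega

open Classical in
lemma exists_tendsto_card_filter_incWords (S : Finset (ℕ × ℕ)) (d : ℕ) :
    ∃ l : ℝ, Tendsto (fun n => (((incWords n d).filter (Satisfies S)).card : ℝ) / catalan n)
      atTop (𝓝 l) := by
  obtain ⟨B, hB⟩ : ∃ B, ∀ p ∈ S, p.1 < B := by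
    obtain ⟨B, hB⟩ := (S.image Prod.fst).exists_nat_subset_range
    exact ⟨B, fun p hp => Finset.mem_range.1 (hB (Finset.mem_image_of_mem _ hp))⟩
  induction B generalizing S d with
  | zero =>
    have hS : S = ∅ := Finset.eq_empty_of_forall_notMem fun p hp => by
      have := hB p hp
      omega
    refine ⟨_, (tendsto_card_incWords d).congr fun n => ?_⟩
    rw [Finset.filter_true_of_mem fun f _ => by simp [Satisfies, hS]]
  | succ B ih =>
    have hpre : ∀ a e, ∃ l : ℝ, Tendsto (fun n => (((incWords n e).filter
        fun g => Satisfies S (prepend n a g)).card : ℝ) / catalan (n + 1)) atTop (𝓝 l) := by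
      intro a e
      by_cases hc : (∀ p ∈ S, p.1 = 0 → p.2 = a) ∧ ∀ p ∈ S, 0 < p.1 → p.2 ≠ a
      · obtain ⟨l, hl⟩ := ih ((S.filter (0 < ·.1)).image
          fun p => (p.1 - 1, if p.2 < a then p.2 else p.2 - 1)) e (by
            simp only [Finset.forall_mem_image, Finset.mem_filter]
            intro p hp
            have := hB p hp.1
            omega)
        refine ⟨_, (hl.mul tendsto_catalan_div_succ).congr' ?_⟩
        filter_upwards [eventually_ge_atTop (B + 1)] with n hn
        rw [div_mul_div_cancel₀ (catalan_cast_pos n).ne']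
        congr 3
        refine Finset.filter_congr fun g _ => ?_
        rw [satisfies_prepend (fun p hp => (hB p hp).trans_le hn)]
        exact (and_iff_right hc).symm
      · refine ⟨0, tendsto_const_nhds.congr' ?_⟩
        filter_upwards [eventually_ge_atTop (B + 1)] with n hn
        rw [Finset.filter_false_of_mem]
        · simp
        · intro g _
          rw [satisfies_prepend (fun p hp => (hB p hp).trans_le hn)]
          exact fun H => hc H.1
    choose l hl using hpre
    suffices h : ∃ x : ℝ, Tendsto (fun n => (((incWords (n + 1) d).filter
        (Satisfies S)).card : ℝ) / catalan (n + 1)) atTop (𝓝 x) by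
      obtain ⟨x, hx⟩ := h
      exact ⟨x, (tendsto_add_atTop_iff_nat 1).1 hx⟩
    refine exists_tendsto_of_approx _ fun ε hε => ?_
    have hq : Tendsto (fun K : ℕ => (K + 1 : ℝ) / 2 ^ K) atTop (𝓝 0) := by
      have h1 := tendsto_self_mul_const_pow_of_lt_one (r := (1 / 2 : ℝ)) (by norm_num)
        (by norm_num)
      have h2 := tendsto_pow_atTop_nhds_zero_of_lt_one (r := (1 / 2 : ℝ)) (by norm_num)
        (by norm_num)
      have h3 := h1.add h2
      rw [add_zero] at h3
      refine h3.congr fun K => ?_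
      rw [one_div, inv_pow]
      ring
    obtain ⟨K, hKε, hKd⟩ := ((hq.eventually (gt_mem_nhds hε)).and
      (eventually_ge_atTop d)).exists
    refine ⟨fun n => ((if d = 0 then 0 else (((incWords n (d - 1)).filter
        fun g => Satisfies S (prepend n 0 g)).card : ℝ) / catalan (n + 1)) +
      ∑ a ∈ Finset.Ico d K, (((incWords n a).filter
        fun g => Satisfies S (prepend n a g)).card : ℝ) / catalan (n + 1)),
      (if d = 0 then 0 else l 0 (d - 1)) + ∑ a ∈ Finset.Ico d K, l a a, ?_, ?_⟩
    · refine Tendsto.add ?_ (tendsto_finsetSum _ fun a _ => hl a a)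
      split_ifs
      · exact tendsto_const_nhds
      · exact hl 0 (d - 1)
    · filter_upwards [((tendsto_card_incWords K).comp (tendsto_add_atTop_nat 1)).eventually
        (gt_mem_nhds hKε), eventually_ge_atTop K] with n hn hnK
      have hC := catalan_cast_pos (n + 1)
      have htail : ∑ a ∈ Finset.Ico K (n + 1), ((incWords n a).filter
          fun g => Satisfies S (prepend n a g)).card ≤ (incWords (n + 1) K).card := by
        rw [card_incWords_succ]
        exact le_add_left (Finset.sum_le_sum fun a _ => Finset.card_filter_le _ _)
      rw [card_filter_incWords_succ, ← Finset.sum_Ico_consecutive _ hKd (by omega : K ≤ n + 1)]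
      have heq : ∀ x y z : ℝ, x / catalan (n + 1) + y / catalan (n + 1) + z / catalan (n + 1) -
          (x / catalan (n + 1) + y / catalan (n + 1)) = z / catalan (n + 1) := by
        intros
        ring
      have hif : ∀ x : ℝ, (if d = 0 then 0 else x / catalan (n + 1)) =
          (if d = 0 then 0 else x) / catalan (n + 1) := by
        intro x
        split_ifs <;> simp
      simp only [hif, ← Finset.sum_div]
      push_cast
      rw [← add_assoc, add_div, add_div, heq,
        abs_of_nonneg (div_nonneg (Finset.sum_nonneg fun _ _ => Nat.cast_nonneg _) hC.le)]
      refine le_trans ?_ hn.le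
      simp only [Function.comp]
      gcongr
      exact_mod_cast htail

lemma converges_321 : Converges p321 := by
  intro S
  obtain ⟨l, hl⟩ := exists_tendsto_card_filter_incWords S 0
  refine ⟨l, hl.congr fun n => ?_⟩
  rw [incWords_zero_right, card_avoidWords_321]

end FirstValue

section Symmetries

lemma ContainsPat.inv {n : ℕ} {π : Equiv.Perm (Fin n)} {σ : Equiv.Perm (Fin 3)}
    (h : ContainsPat π σ) : ContainsPat π⁻¹ σ⁻¹ := by
  obtain ⟨f, hf, h⟩ := h
  refine ⟨fun a => π (f (σ⁻¹ a)), fun a b hab => (h _ _).1 (by simpa using hab), fun a b => ?_⟩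
  simp [hf.lt_iff_lt]

lemma ContainsPat.reverse {n : ℕ} {π : Equiv.Perm (Fin n)} {σ : Equiv.Perm (Fin 3)}
    (h : ContainsPat π σ) : ContainsPat (π * Fin.revPerm) (σ * Fin.revPerm) := by
  obtain ⟨f, hf, h⟩ := h
  refine ⟨fun a => Fin.rev (f (Fin.rev a)), fun a b hab => ?_, fun a b => ?_⟩
  · simpa using hf (Fin.rev_lt_rev.2 hab)
  · simpa using h (Fin.rev a) (Fin.rev b)

lemma inv_mem_avoidFinset {n : ℕ} {π : Equiv.Perm (Fin n)} {σ : Equiv.Perm (Fin 3)} :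
    π⁻¹ ∈ avoidFinset σ⁻¹ n ↔ π ∈ avoidFinset σ n := by
  rw [mem_avoidFinset, mem_avoidFinset, AvoidsPat, AvoidsPat, not_iff_not]
  exact ⟨fun h => by simpa using h.inv, ContainsPat.inv⟩

lemma mul_revPerm_mul_revPerm {m : ℕ} (τ : Equiv.Perm (Fin m)) :
    τ * Fin.revPerm * Fin.revPerm = τ := by
  ext
  simp

lemma reverse_mem_avoidFinset {n : ℕ} {π : Equiv.Perm (Fin n)} {σ : Equiv.Perm (Fin 3)} :
    π * Fin.revPerm ∈ avoidFinset (σ * Fin.revPerm) n ↔ π ∈ avoidFinset σ n := by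
  rw [mem_avoidFinset, mem_avoidFinset, AvoidsPat, AvoidsPat, not_iff_not]
  exact ⟨fun h => by simpa only [mul_revPerm_mul_revPerm] using h.reverse, ContainsPat.reverse⟩

lemma card_avoidFinset_mul_revPerm (σ : Equiv.Perm (Fin 3)) (n : ℕ) :
    (avoidFinset (σ * Fin.revPerm) n).card = (avoidFinset σ n).card := by
  symm
  refine Finset.card_nbij' (fun π => π * Fin.revPerm) (fun π => π * Fin.revPerm)
    (fun π hπ => reverse_mem_avoidFinset.2 hπ) (fun π hπ => ?_)
    (fun π _ => mul_revPerm_mul_revPerm π) (fun π _ => mul_revPerm_mul_revPerm π)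
  have h := reverse_mem_avoidFinset.2 hπ
  rwa [mul_revPerm_mul_revPerm] at h

lemma card_avoidWords (σ : Equiv.Perm (Fin 3)) (n : ℕ) :
    (avoidWords σ n).card = (avoidFinset σ n).card := Finset.card_map _

open Classical in
lemma card_filter_avoidWords (σ : Equiv.Perm (Fin 3)) (n : ℕ) (S : Finset (ℕ × ℕ)) :
    ((avoidWords σ n).filter (Satisfies S)).card =
      ((avoidFinset σ n).filter fun π => Satisfies S (wordOf π)).card := by
  rw [avoidWords, Finset.filter_map, Finset.card_map]
  rfl

lemma wordOf_inv_eq_iff {n : ℕ} (π : Equiv.Perm (Fin n)) {a b : ℕ} (ha : a < n) (hb : b < n) :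
    wordOf π⁻¹ b = a ↔ wordOf π a = b := by
  have h1 : wordOf π⁻¹ b = a ↔ π⁻¹ ⟨b, hb⟩ = ⟨a, ha⟩ := by simp [wordOf, hb, Fin.ext_iff]
  have h2 : wordOf π a = b ↔ π ⟨a, ha⟩ = ⟨b, hb⟩ := by simp [wordOf, ha, Fin.ext_iff]
  rw [h1, h2, Equiv.Perm.inv_eq_iff_eq, eq_comm]

lemma exists_forall_mem_lt (S : Finset (ℕ × ℕ)) : ∃ N, ∀ p ∈ S, p.1 < N ∧ p.2 < N := by
  obtain ⟨A, hA⟩ := (S.image Prod.fst).exists_nat_subset_range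
  obtain ⟨B, hB⟩ := (S.image Prod.snd).exists_nat_subset_range
  refine ⟨max A B, fun p hp => ⟨?_, ?_⟩⟩
  · exact (Finset.mem_range.1 (hA (Finset.mem_image_of_mem _ hp))).trans_le (le_max_left _ _)
  · exact (Finset.mem_range.1 (hB (Finset.mem_image_of_mem _ hp))).trans_le (le_max_right _ _)

open Classical in
lemma card_filter_avoidWords_inv {σ : Equiv.Perm (Fin 3)} {n : ℕ} {S : Finset (ℕ × ℕ)}
    (hS : ∀ p ∈ S, p.1 < n ∧ p.2 < n) :
    ((avoidWords σ⁻¹ n).filter (Satisfies S)).card =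
      ((avoidWords σ n).filter (Satisfies (S.image Prod.swap))).card := by
  rw [card_filter_avoidWords, card_filter_avoidWords]
  symm
  have key : ∀ π : Equiv.Perm (Fin n),
      Satisfies S (wordOf π⁻¹) ↔ Satisfies (S.image Prod.swap) (wordOf π) := by
    intro π
    simp only [Satisfies, Finset.forall_mem_image, Prod.fst_swap, Prod.snd_swap]
    exact forall₂_congr fun p hp => wordOf_inv_eq_iff π (hS p hp).2 (hS p hp).1
  refine Finset.card_nbij' (fun π => π⁻¹) (fun π => π⁻¹) (fun π hπ => ?_) (fun π hπ => ?_)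
    (fun π _ => inv_inv π) (fun π _ => inv_inv π)
  · simp only [Finset.coe_filter, mem_ofPred_eq] at hπ ⊢
    exact ⟨inv_mem_avoidFinset.2 hπ.1, (key π).2 hπ.2⟩
  · simp only [Finset.coe_filter, mem_ofPred_eq] at hπ ⊢
    have h1 := inv_mem_avoidFinset.2 hπ.1
    rw [inv_inv] at h1
    refine ⟨h1, (key π⁻¹).1 ?_⟩
    rw [inv_inv]
    exact hπ.2

lemma card_avoidWords_inv (σ : Equiv.Perm (Fin 3)) (n : ℕ) :
    (avoidWords σ⁻¹ n).card = (avoidWords σ n).card := by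
  classical
  have h := card_filter_avoidWords_inv (σ := σ) (n := n) (S := ∅) (by simp)
  rwa [Finset.filter_true_of_mem fun f _ => by simp [Satisfies],
    Finset.filter_true_of_mem fun f _ => by simp [Satisfies]] at h

lemma Converges.inv {σ : Equiv.Perm (Fin 3)} (hσ : Converges σ) : Converges σ⁻¹ := by
  intro S
  obtain ⟨N, hN⟩ := exists_forall_mem_lt S
  obtain ⟨l, hl⟩ := hσ (S.image Prod.swap)
  refine ⟨l, hl.congr' ?_⟩
  filter_upwards [eventually_ge_atTop N] with n hn
  rw [card_avoidWords_inv, card_filter_avoidWords_inv fun p hp =>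
    ⟨(hN p hp).1.trans_le hn, (hN p hp).2.trans_le hn⟩]

lemma inv_p312 : p312⁻¹ = p231 := by
  rw [inv_eq_iff_mul_eq_one]
  decide

lemma p231_mul_revPerm : p231 * Fin.revPerm = p132 := by decide

lemma p321_mul_revPerm : p321 * Fin.revPerm = p123 := by decide

lemma card_avoidWords_132 (n : ℕ) : (avoidWords p132 n).card = catalan n := by
  rw [card_avoidWords, ← p231_mul_revPerm, card_avoidFinset_mul_revPerm, ← card_avoidWords,
    ← inv_p312, card_avoidWords_inv, card_avoidWords_312]

lemma card_avoidWords_123 (n : ℕ) : (avoidWords p123 n).card = catalan n := by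
  rw [card_avoidWords, ← p321_mul_revPerm, card_avoidFinset_mul_revPerm, ← card_avoidWords,
    card_avoidWords_321]

end Symmetries

section Degenerate

/-- If a pattern starts with its minimum, then the entries above and to the right of a given entry
of an avoiding permutation are determined by the other entries. -/
lemma eq_of_avoidsPat {n : ℕ} {σ : Equiv.Perm (Fin 3)} (h01 : σ 0 < σ 1) (h02 : σ 0 < σ 2)
    {π ρ : Equiv.Perm (Fin n)} (hπ : AvoidsPat π σ) (hρ : AvoidsPat ρ σ) {i a : Fin n}
    (hπi : π i = a) (hpos : ∀ k ≤ i, π k = ρ k) (hval : ∀ v ≤ a, π⁻¹ v = ρ⁻¹ v) : π = ρ := by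
  by_contra hne
  have hex : ∃ p, π p ≠ ρ p := by
    by_contra! h
    exact hne (Equiv.ext h)
  obtain ⟨p, hp, hmin⟩ := WellFounded.has_min (wellFounded_lt (α := Fin n)) {p | π p ≠ ρ p} hex
  replace hmin : ∀ k < p, π k = ρ k := fun k hk => by
    by_contra h
    exact hmin k h hk
  have hip : i < p := by
    by_contra h
    exact hp (hpos p (not_lt.1 h))
  have hap : a < π p := by
    by_contra h
    have := hval _ (not_lt.1 h)
    rw [show π⁻¹ (π p) = p from π.symm_apply_apply p, Equiv.Perm.eq_inv_iff_eq] at this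
    exact hp this.symm
  have hap' : a < ρ p := by
    by_contra h
    have := hval _ (not_lt.1 h)
    rw [show ρ⁻¹ (ρ p) = p from ρ.symm_apply_apply p, Equiv.Perm.inv_eq_iff_eq] at this
    exact hp this.symm
  have hρi : ρ i = a := by rw [← hpos i le_rfl, hπi]
  have hq : p < ρ⁻¹ (π p) := by
    by_contra h
    rcases (not_lt.1 h).lt_or_eq with h | h
    · have h1 := hmin _ h
      rw [show ρ (ρ⁻¹ (π p)) = π p from ρ.apply_symm_apply _] at h1
      exact h.ne (π.injective h1)
    · rw [Equiv.Perm.inv_eq_iff_eq] at h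
      exact hp h
  have hq' : p < π⁻¹ (ρ p) := by
    by_contra h
    rcases (not_lt.1 h).lt_or_eq with h | h
    · have h1 := hmin _ h
      rw [show π (π⁻¹ (ρ p)) = ρ p from π.apply_symm_apply _] at h1
      exact h.ne (ρ.injective h1.symm)
    · rw [Equiv.Perm.inv_eq_iff_eq] at h
      exact hp h.symm
  by_cases h : (σ 1 < σ 2 ↔ π p < ρ p)
  · refine hπ (containsPat_iff.2 ⟨i, p, _, hip, hq', ?_, ?_, ?_⟩) <;>
      simp [*]
  · have h12 : (σ 1 < σ 2 ↔ ρ p < π p) := by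
      rcases lt_or_gt_of_ne hp with h3 | h3 <;> simp_all [h3.not_gt]
    refine hρ (containsPat_iff.2 ⟨i, p, _, hip, hq, ?_, ?_, ?_⟩) <;>
      simp [*]

open Classical in
lemma card_filter_avoidFinset_le {n : ℕ} {σ : Equiv.Perm (Fin 3)} (h01 : σ 0 < σ 1)
    (h02 : σ 0 < σ 2) (i a : Fin n) :
    ((avoidFinset σ n).filter fun π => π i = a).card ≤ n ^ ((i : ℕ) + a + 2) := by
  let F : Equiv.Perm (Fin n) → (Fin (i + 1) → Fin n) × (Fin (a + 1) → Fin n) := fun π =>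
    (fun k => π (k.castLE i.2), fun v => π⁻¹ (v.castLE a.2))
  have hF : InjOn F ((avoidFinset σ n).filter fun π => π i = a) := by
    intro π hπ ρ hρ h
    simp only [Finset.coe_filter, mem_ofPred_eq, mem_avoidFinset] at hπ hρ
    rw [Prod.ext_iff, funext_iff, funext_iff] at h
    refine eq_of_avoidsPat h01 h02 hπ.1 hρ.1 hπ.2 (fun k hk => ?_) (fun v hv => ?_)
    · exact h.1 ⟨k, Nat.lt_succ_of_le hk⟩
    · exact h.2 ⟨v, Nat.lt_succ_of_le hv⟩
  refine (Finset.card_le_card_of_injOn (t := Finset.univ) F (fun _ _ => by simp) hF).trans ?_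
  rw [Finset.card_univ, Fintype.card_prod, Fintype.card_fun, Fintype.card_fun, Fintype.card_fin,
    Fintype.card_fin, Fintype.card_fin, ← pow_add]
  exact (congrArg (n ^ ·) (by ring)).le

lemma tendsto_pow_div_catalan (k : ℕ) :
    Tendsto (fun n : ℕ => (n : ℝ) ^ k / catalan n) atTop (𝓝 0) := by
  have h := (tendsto_pow_const_div_const_pow_of_one_lt (k + 2)
    (show (1 : ℝ) < 4 by norm_num)).const_mul 4
  rw [mul_zero] at h
  refine squeeze_zero' (Eventually.of_forall fun n => by positivity) ?_ h
  filter_upwards [eventually_ge_atTop 1] with n hn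
  have h1 : 4 ^ n ≤ 4 * n ^ 2 * catalan n := by
    have h2 := Nat.four_pow_le_two_mul_self_mul_centralBinom n hn
    rw [← succ_mul_catalan_eq_centralBinom] at h2
    refine h2.trans ?_
    have : 2 * n * (n + 1) ≤ 4 * n ^ 2 := by nlinarith
    calc 2 * n * ((n + 1) * catalan n) = 2 * n * (n + 1) * catalan n := by ring
      _ ≤ _ := Nat.mul_le_mul_right _ this
  have h2 : (4 : ℝ) ^ n ≤ 4 * n ^ 2 * catalan n := by exact_mod_cast h1
  rw [← mul_div_assoc, div_le_div_iff₀ (catalan_cast_pos n) (by positivity)]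
  calc (n : ℝ) ^ k * 4 ^ n ≤ n ^ k * (4 * n ^ 2 * catalan n) := by gcongr
    _ = 4 * n ^ (k + 2) * catalan n := by ring

lemma converges_of_lt {σ : Equiv.Perm (Fin 3)} (h01 : σ 0 < σ 1) (h02 : σ 0 < σ 2)
    (hcard : ∀ n, (avoidWords σ n).card = catalan n) : Converges σ := by
  classical
  intro S
  simp_rw [hcard]
  rcases S.eq_empty_or_nonempty with rfl | ⟨⟨i, a⟩, hS⟩
  · refine ⟨1, tendsto_const_nhds.congr fun n => ?_⟩
    rw [Finset.filter_true_of_mem fun f _ => by simp [Satisfies], hcard,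
      div_self (catalan_cast_pos n).ne']
  · refine ⟨0, squeeze_zero' (Eventually.of_forall fun n => by positivity) ?_
      (tendsto_pow_div_catalan (i + a + 2))⟩
    filter_upwards [eventually_gt_atTop (max i a)] with n hn
    obtain ⟨hi, ha⟩ := max_lt_iff.1 hn
    have h := card_filter_avoidFinset_le h01 h02 ⟨i, hi⟩ ⟨a, ha⟩
    have h' : ((avoidWords σ n).filter (Satisfies S)).card ≤ n ^ (i + a + 2) := by
      rw [card_filter_avoidWords]
      refine (Finset.card_le_card fun π hπ => ?_).trans h
      rw [Finset.mem_filter] at hπ ⊢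
      have h1 := hπ.2 _ hS
      simp only [wordOf, hi, dif_pos] at h1
      exact ⟨hπ.1, Fin.ext h1⟩
    gcongr
    exact_mod_cast h'

lemma converges (σ : Equiv.Perm (Fin 3)) : Converges σ := by
  rcases pattern_cases σ with rfl | rfl | rfl | rfl | rfl | rfl
  · exact converges_of_lt (by decide) (by decide) card_avoidWords_123
  · exact converges_of_lt (by decide) (by decide) card_avoidWords_132
  · exact converges_213
  · exact inv_p312 ▸ converges_312.inv
  · exact converges_312
  · exact converges_321

end Degenerate

section Law

open Classical in
lemma uniformAvoidLaw_real {σ : Equiv.Perm (Fin 3)} {n : ℕ} {A : Set (ℕ → ℕ∞)}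
    (hA : MeasurableSet A) : (uniformAvoidLaw σ n).real A =
      (((avoidFinset σ n).filter fun π => embedPerm π ∈ A).card : ℝ) /
        (avoidFinset σ n).card := by
  have h : (∑ π ∈ avoidFinset σ n, Measure.dirac (embedPerm π)) A =
      ((avoidFinset σ n).filter fun π => embedPerm π ∈ A).card := by
    rw [Measure.finsetSum_apply, Finset.card_filter, Nat.cast_sum]
    refine Finset.sum_congr rfl fun π _ => ?_
    rw [Measure.dirac_apply' _ hA]
    simp [indicator]
  rw [Measure.real, uniformAvoidLaw, Measure.smul_apply, h, smul_eq_mul, ENNReal.toReal_mul,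
    ENNReal.toReal_inv, ENNReal.toReal_natCast, ENNReal.toReal_natCast, div_eq_inv_mul]

lemma embedPerm_mem_cylinder {n : ℕ} {π : Equiv.Perm (Fin n)} {S : Finset (ℕ × ℕ)}
    (hS : ∀ p ∈ S, p.1 < n) : embedPerm π ∈ cylinder S ↔
      ((∀ p ∈ S, p.1 = 0 → p.2 = 0) ∧ ∀ p ∈ S, 0 < p.1 → 0 < p.2) ∧
      Satisfies ((S.filter (0 < ·.1)).image fun p => (p.1 - 1, p.2 - 1)) (wordOf π) := by
  simp only [cylinder, mem_ofPred_eq, Satisfies, Finset.forall_mem_image, Finset.mem_filter,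
    ← forall_and, and_imp]
  refine forall₂_congr fun p hp => ?_
  have hpn := hS p hp
  obtain ⟨k, v⟩ := p
  cases k with
  | zero =>
    simp [embedPerm, eq_comm]
  | succ k =>
    simp only at hpn
    have h1 : k < n := by omega
    have h2 : 1 ≤ k + 1 ∧ k + 1 ≤ n := by omega
    simp only [k.succ_ne_zero, k.succ_pos, false_implies, true_implies, true_and, embedPerm, h2,
      wordOf, Nat.add_sub_cancel, h1, dif_pos, and_self, ENat.natCast_inj]
    omega

end Law

/-- Fix a pattern `σ ∈ S_3`.  Let `Π_n^σ` (with law `Pn n`) be a uniformly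
random permutation of `[n]` conditioned to avoid `σ`, viewed as a random element of
`F(ℕ, ℕ*)`.  Then there is an `F(ℕ, ℕ*)`-valued random variable `Π^σ` (with law `Plim`)
such that `Π_n^σ → Π^σ` in distribution as `n → ∞`. -/
theorem local_limit_exists (σ : Equiv.Perm (Fin 3))
    (Pn : ℕ → ProbabilityMeasure (ℕ → ℕ∞))
    (hPn : ∀ n : ℕ, (Pn n : Measure (ℕ → ℕ∞)) = uniformAvoidLaw σ n) :
    ∃ Plim : ProbabilityMeasure (ℕ → ℕ∞), Tendsto Pn atTop (𝓝 Plim) := by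
  classical
  refine exists_tendsto_of_cylinder Pn fun S => ?_
  obtain ⟨N, hN⟩ := exists_forall_mem_lt S
  simp_rw [hPn, uniformAvoidLaw_real (isClopen_cylinder S).isClosed.measurableSet]
  by_cases hc : (∀ p ∈ S, p.1 = 0 → p.2 = 0) ∧ ∀ p ∈ S, 0 < p.1 → 0 < p.2
  · obtain ⟨l, hl⟩ := converges σ ((S.filter (0 < ·.1)).image fun p => (p.1 - 1, p.2 - 1))
    refine ⟨l, hl.congr' ?_⟩
    filter_upwards [eventually_ge_atTop N] with n hn
    rw [card_filter_avoidWords, card_avoidWords]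
    congr 3
    refine Finset.filter_congr fun π _ => ?_
    rw [embedPerm_mem_cylinder fun p hp => (hN p hp).1.trans_le hn]
    exact (and_iff_right hc).symm
  · refine ⟨0, tendsto_const_nhds.congr' ?_⟩
    filter_upwards [eventually_ge_atTop N] with n hn
    rw [Finset.filter_false_of_mem]
    · simp
    · intro π _
      rw [embedPerm_mem_cylinder fun p hp => (hN p hp).1.trans_le hn]
      exact fun H => hc H.1

end AvoidPaper
end

section
/- For σ ∈ {321, 123}, the map t ↦ Φ_t^σ is a bijection from the set 𝔗_{n+1} of rooted ordered trees with n+1 vertices to the set Av_n(σ) of permutations of [n] avoiding σ. Here, for a finite rooted ordered tree t with k leaves l_1 < ⋯ < l_k in lexicographic order, with s_i = #{v ∈ t : v < l_i} and p_i = |l_i| (the height of l_i), the permutation Φ_t^{321} of [n] (n = |t| − 1) is defined by Φ_t^{321}(s_i − p_i + 1) = s_i for 1 ≤ i ≤ k, extended to the complement of {s_i − p_i + 1 : 1 ≤ i ≤ k} in [n] by the unique increasing bijection onto the complement of {s_i : 1 ≤ i ≤ k} in [n]; and Φ_t^{123} = |t| + 1 − Φ_t^{321}. -/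
open Set Filter MeasureTheory Topology TopologicalSpace
open scoped ENNReal

namespace AvoidPaper

/-! ## Codes of permutations -/

/-- A weakly increasing sequence lying below the diagonal, with value `n` at `n`. -/
structure IsCode (n : ℕ) (c : ℕ → ℕ) : Prop where
  mono : Monotone c
  le : ∀ k, c k ≤ k
  top : c n = n

/-- `π` maps each value `c k` to the last index at which it is attained, and is increasing on
the positions which are not values of `c`. -/
def IsCodePerm (n : ℕ) (c : ℕ → ℕ) (π : Equiv.Perm (Fin n)) : Prop :=
  (∀ k < n, c k < c (k + 1) → ∃ h : c k < n, (π ⟨c k, h⟩ : ℕ) = k) ∧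
  ∀ a b : Fin n, a < b → (∀ k < n, c k ≠ a) → (∀ k < n, c k ≠ b) → π a < π b

namespace IsCode

variable {n : ℕ} {c : ℕ → ℕ}

lemma exists_last (hc : IsCode n c) {k : ℕ} (hk : k < n) :
    ∃ m, k ≤ m ∧ m < n ∧ c m = c k ∧ c m < c (m + 1) := by
  have hP : ∃ m, k ≤ m ∧ c k < c (m + 1) :=
    ⟨n - 1, by omega, by
      rw [Nat.sub_add_cancel (by omega), hc.top]
      exact (hc.le k).trans_lt hk⟩
  classical
  obtain ⟨hkm, hlt⟩ := Nat.find_spec hP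
  have hmin : Nat.find hP ≤ n - 1 := Nat.find_min' hP ⟨by omega, by
      rw [Nat.sub_add_cancel (by omega), hc.top]
      exact (hc.le k).trans_lt hk⟩
  set m := Nat.find hP with hm
  have hck : c m = c k := by
    rcases hkm.eq_or_lt with h | h
    · rw [← h]
    · refine le_antisymm ?_ (hc.mono hkm)
      by_contra hcon
      have := Nat.find_min' hP (m := m - 1)
        ⟨by omega, by rw [Nat.sub_add_cancel (by omega)]; omega⟩
      omega
  exact ⟨m, hkm, by omega, hck, by omega⟩

lemma lt_of_lt (hc : IsCode n c) {k m : ℕ} (h : c k < c m) : k < m :=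
  lt_of_not_ge fun h' => absurd (hc.mono h') (not_le.2 h)

lemma eq_of_last (hc : IsCode n c) {k m : ℕ} (hk : c k < c (k + 1)) (hm : c m < c (m + 1))
    (h : c k = c m) : k = m := by
  have h1 := hc.lt_of_lt (k := k) (m := m + 1) (by omega)
  have h2 := hc.lt_of_lt (k := m) (m := k + 1) (by omega)
  omega

end IsCode

namespace IsCodePerm

variable {n : ℕ} {c : ℕ → ℕ} {π π' : Equiv.Perm (Fin n)}

lemma lt_of_forall_ne (hc : IsCode n c) (h : IsCodePerm n c π) {a : Fin n}
    (ha : ∀ k < n, c k ≠ a) : π a < a := by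
  by_contra! hge
  have hge' : (a : ℕ) ≤ (π a : ℕ) := hge
  set j := (π a : ℕ) with hj
  have hjn : j < n := (π a).2
  have hcj : c j ≤ j := hc.le j
  obtain ⟨m, hjm, hmn, hcm, hlast⟩ := hc.exists_last hjn
  obtain ⟨hcn, hπm⟩ := h.1 m hmn hlast
  have hjm' : j < m := by
    refine lt_of_le_of_ne hjm fun e => ha m hmn ?_
    have : π ⟨c m, hcn⟩ = π a := Fin.ext (by rw [hπm, ← e])
    exact congrArg Fin.val (π.injective this)
  have key : ∀ v ∈ Finset.range (j + 1), ∃ p ∈ (Finset.range (max (a : ℕ) (c j) + 1)).erase (c j),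
      ∃ hp : p < n, (π ⟨p, hp⟩ : ℕ) = v := by
    intro v hv
    have hv' : v ≤ j := by simpa [Nat.lt_succ_iff] using hv
    have hvn : v < n := by omega
    obtain ⟨p, hp⟩ := π.surjective ⟨v, hvn⟩
    have hpv : (π p : ℕ) = v := by rw [hp]
    refine ⟨p, ?_, p.2, hpv⟩
    rw [Finset.mem_erase, Finset.mem_range]
    constructor
    · intro e
      have : p = ⟨c m, hcn⟩ := Fin.ext (by simp [e, hcm])
      rw [this, hπm] at hpv
      omega
    · by_cases hpB : ∀ k < n, c k ≠ p
      · have : p ≤ a := by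
          by_contra! hlt
          have h2 : (π a : ℕ) < π p := h.2 a p hlt ha hpB
          omega
        have : (p : ℕ) ≤ a := this
        omega
      · push Not at hpB
        obtain ⟨k, hk, hkp⟩ := hpB
        obtain ⟨q, -, hqn, hcq, hql⟩ := hc.exists_last hk
        obtain ⟨hh, hπq⟩ := h.1 q hqn hql
        have : p = ⟨c q, hh⟩ := Fin.ext (by simp [← hkp, hcq])
        rw [this, hπq] at hpv
        have := hc.mono (show q ≤ j by omega)
        omega
  choose! f hf hfn hfv using key
  have hinj : Set.InjOn f (Finset.range (j + 1)) := by
    intro x hx y hy hxy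
    rw [← hfv x hx, ← hfv y hy]
    simp [hxy]
  have hcard := Finset.card_le_card_of_injOn f hf hinj
  rw [Finset.card_erase_of_mem (by simp), Finset.card_range, Finset.card_range] at hcard
  omega

lemma code_le (hc : IsCode n c) (h : IsCodePerm n c π) {k : ℕ} {i : Fin n}
    (hki : k ≤ (π i : ℕ)) : c k ≤ i := by
  by_cases hB : ∀ m < n, c m ≠ i
  · have h1 : (π i : ℕ) < i := h.lt_of_forall_ne hc hB
    have := hc.le k
    omega
  · push Not at hB
    obtain ⟨m, hm, hmi⟩ := hB
    obtain ⟨q, -, hqn, hcq, hql⟩ := hc.exists_last hm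
    obtain ⟨hh, hπq⟩ := h.1 q hqn hql
    have : i = ⟨c q, hh⟩ := Fin.ext (by simp [← hmi, hcq])
    rw [this, hπq] at hki
    rw [this]
    exact hc.mono hki

lemma code_unique {c' : ℕ → ℕ} (hc : IsCode n c) (hc' : IsCode n c')
    (h : IsCodePerm n c π) (h' : IsCodePerm n c' π) : ∀ k < n, c k = c' k := by
  have aux : ∀ {c c' : ℕ → ℕ}, IsCode n c → IsCode n c' → IsCodePerm n c π →
      IsCodePerm n c' π → ∀ k < n, c k ≤ c' k := by
    intro c c' hc hc' h h' k hk
    obtain ⟨q, hkq, hqn, hcq, hql⟩ := hc'.exists_last hk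
    obtain ⟨hh, hπq⟩ := h'.1 q hqn hql
    have := h.code_le hc (k := k) (i := ⟨c' q, hh⟩) (by omega)
    simpa [hcq] using this
  exact fun k hk => le_antisymm (aux hc hc' h h' k hk) (aux hc' hc h' h k hk)

lemma image_mem (hc : IsCode n c) (h : IsCodePerm n c π) {k : ℕ} (hk : k < n) :
    ∃ m, ∃ hm : m < n, ∃ hcm : c m < n, c m = c k ∧ c m < c (m + 1) ∧
      π ⟨c m, hcm⟩ = ⟨m, hm⟩ := by
  obtain ⟨q, -, hqn, hcq, hql⟩ := hc.exists_last hk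
  obtain ⟨hh, hπq⟩ := h.1 q hqn hql
  exact ⟨q, hqn, hh, hcq, hql, Fin.ext hπq⟩

lemma avoids (hc : IsCode n c) (h : IsCodePerm n c π) : AvoidsPat π p321 := by
  rintro ⟨f, hf, hpat⟩
  have h10 : π (f 1) < π (f 0) := (hpat 1 0).1 (by simp [p321])
  have h21 : π (f 2) < π (f 1) := (hpat 2 1).1 (by simp [p321])
  have hB : ∀ a b : Fin n, a < b → π b < π a →
      ¬ ((∃ k < n, c k = a) ∧ ∃ k < n, c k = b) := by
    rintro a b hab hlt ⟨⟨k, hk, hka⟩, l, hl, hlb⟩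
    obtain ⟨x, hx, hx', hxk, hxl, hπx⟩ := h.image_mem hc hk
    obtain ⟨y, hy, hy', hyk, hyl, hπy⟩ := h.image_mem hc hl
    have ea : a = ⟨c x, hx'⟩ := Fin.ext (by simp [← hka, hxk])
    have eb : b = ⟨c y, hy'⟩ := Fin.ext (by simp [← hlb, hyk])
    rw [ea, eb, hπx, hπy, Fin.mk_lt_mk] at hlt
    rw [ea, eb, Fin.mk_lt_mk] at hab
    exact absurd (hc.mono hlt.le) (not_le.2 hab)
  have hN : ∀ a b : Fin n, a < b → π b < π a → (∃ k < n, c k = a) ∨ ∃ k < n, c k = b := by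
    intro a b hab hlt
    by_contra! hcon
    exact absurd (h.2 a b hab hcon.1 hcon.2) (not_lt.2 hlt.le)
  have l01 : f 0 < f 1 := hf (by decide)
  have l12 : f 1 < f 2 := hf (by decide)
  have b01 := hB _ _ l01 h10
  have b12 := hB _ _ l12 h21
  have b02 := hB _ _ (l01.trans l12) (h21.trans h10)
  rcases hN _ _ l01 h10 with h0 | h1
  · rcases hN _ _ l12 h21 with h1 | h2
    · exact b01 ⟨h0, h1⟩
    · exact b02 ⟨h0, h2⟩
  · rcases hN _ _ (l01.trans l12) (h21.trans h10) with h0 | h2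
    · exact b01 ⟨h0, h1⟩
    · exact b12 ⟨h1, h2⟩

lemma apply_mem_iff (hc : IsCode n c) (h : IsCodePerm n c π) (a : Fin n) :
    (∀ k < n, c k ≠ a) ↔ ¬ c (π a) < c (π a + 1) := by
  constructor
  · intro ha hlast
    obtain ⟨hh, he⟩ := h.1 _ (π a).2 hlast
    exact ha _ (π a).2 (congrArg Fin.val (π.injective (Fin.ext he)))
  · intro hlast k hk hka
    obtain ⟨x, hx, hx', hxk, hxl, hπx⟩ := h.image_mem hc hk
    have ea : a = ⟨c x, hx'⟩ := Fin.ext (by simp [← hka, hxk])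
    rw [ea, hπx] at hlast
    exact hlast hxl

lemma perm_unique (hc : IsCode n c) (h : IsCodePerm n c π) (h' : IsCodePerm n c π') :
    π = π' := by
  let f : Equiv.Perm (Fin n) → {a : Fin n // ∀ k < n, c k ≠ a} → Fin n := fun ρ a => ρ a
  have hmono : ∀ {ρ}, IsCodePerm n c ρ → StrictMono (f ρ) :=
    fun hρ a b hab => hρ.2 a b hab a.2 b.2
  have hrange : ∀ {ρ}, IsCodePerm n c ρ →
      Set.range (f ρ) = {x : Fin n | ¬ c x < c (x + 1)} := by
    intro ρ hρ
    ext x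
    constructor
    · rintro ⟨a, rfl⟩
      exact (hρ.apply_mem_iff hc a).1 a.2
    · intro hx
      refine ⟨⟨ρ.symm x, (hρ.apply_mem_iff hc _).2 (by simpa using hx)⟩, by simp [f]⟩
  have hff : f π = f π' :=
    ((hmono h).range_inj (hmono h')).1 ((hrange h).trans (hrange h').symm)
  ext a : 1
  by_cases ha : ∀ k < n, c k ≠ a
  · exact congrFun hff ⟨a, ha⟩
  · push Not at ha
    obtain ⟨k, hk, hka⟩ := ha
    obtain ⟨x, hx, hx', hxk, hxl, hπx⟩ := h.image_mem hc hk
    obtain ⟨hh, he⟩ := h'.1 x hx hxl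
    have ea : a = ⟨c x, hx'⟩ := Fin.ext (by simp [← hka, hxk])
    rw [ea, hπx]
    exact Fin.ext he.symm

end IsCodePerm

lemma IsCode.exists_perm {n : ℕ} {c : ℕ → ℕ} (hc : IsCode n c) :
    ∃ π : Equiv.Perm (Fin n), IsCodePerm n c π := by
  classical
  let p : Fin n → Prop := fun x => c x < c (x + 1)
  let q : Fin n → Prop := fun a => ∃ k < n, c k = a
  have hlt : ∀ k < n, c k < n := fun k hk => (hc.le k).trans_lt hk
  let g : {x // p x} → {a // q a} := fun x => ⟨⟨c x.1, hlt _ x.1.2⟩, x.1, x.1.2, rfl⟩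
  have hg : Function.Bijective g := by
    constructor
    · intro x y hxy
      have : c x.1 = c y.1 := congrArg (fun z : {a // q a} => (z.1 : ℕ)) hxy
      exact Subtype.ext (Fin.ext (hc.eq_of_last x.2 y.2 this))
    · rintro ⟨a, k, hk, hka⟩
      obtain ⟨m, -, hmn, hcm, hml⟩ := hc.exists_last hk
      exact ⟨⟨⟨m, hmn⟩, hml⟩, Subtype.ext (Fin.ext (hcm.trans hka))⟩
  let e : {a // q a} ≃ {x // p x} := (Equiv.ofBijective g hg).symm
  have hcard : Fintype.card {a // ¬ q a} = Fintype.card {x // ¬ p x} := by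
    rw [Fintype.card_subtype_compl, Fintype.card_subtype_compl, Fintype.card_congr e]
  let o : {a // ¬ q a} ≃o {x // ¬ p x} :=
    (Fintype.orderIsoFinOfCardEq _ hcard).symm.trans (Fintype.orderIsoFinOfCardEq _ rfl)
  refine ⟨Equiv.subtypeCongr e o.toEquiv, ?_, ?_⟩
  · intro k hk hkl
    refine ⟨hlt k hk, ?_⟩
    have hq : q ⟨c k, hlt k hk⟩ := ⟨k, hk, rfl⟩
    have he : e ⟨_, hq⟩ = ⟨⟨k, hk⟩, hkl⟩ := by
      rw [Equiv.symm_apply_eq]; rfl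
    simp [Equiv.subtypeCongr, Equiv.sumCompl_symm_apply_of_pos hq, he]
  · intro a b hab ha hb
    have ha' : ¬ q a := by rintro ⟨k, hk, h⟩; exact ha k hk h
    have hb' : ¬ q b := by rintro ⟨k, hk, h⟩; exact hb k hk h
    have := o.strictMono (show (⟨a, ha'⟩ : {a // ¬ q a}) < ⟨b, hb'⟩ from hab)
    simpa [Equiv.subtypeCongr, Equiv.sumCompl_symm_apply_of_neg ha',
      Equiv.sumCompl_symm_apply_of_neg hb'] using this

/-- Every `321`-avoiding permutation comes from the code given by the first positions at which
the successive levels are reached. -/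
lemma AvoidsPat.exists_code {n : ℕ} {π : Equiv.Perm (Fin n)} (hπ : AvoidsPat π p321) :
    ∃ c, IsCode n c ∧ (∀ k, n ≤ k → c k = n) ∧ IsCodePerm n c π := by
  classical
  let P : ℕ → ℕ → Prop := fun k i => i = n ∨ ∃ h : i < n, k ≤ (π ⟨i, h⟩ : ℕ)
  have hP : ∀ k, ∃ i, P k i := fun k => ⟨n, Or.inl rfl⟩
  let c : ℕ → ℕ := fun k => Nat.find (hP k)
  have hspec : ∀ k, P k (c k) := fun k => Nat.find_spec (hP k)
  have hmin : ∀ {k i}, P k i → c k ≤ i := fun h => Nat.find_min' _ h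
  have htop : ∀ k, n ≤ k → c k = n := by
    intro k hk
    rcases hspec k with h | ⟨h, h'⟩
    · exact h
    · have := (π ⟨c k, h⟩).2
      omega
  have hc : IsCode n c := by
    refine ⟨?_, ?_, htop n le_rfl⟩
    · intro k m hkm
      refine hmin ?_
      rcases hspec m with h | ⟨h, h'⟩
      · exact Or.inl h
      · exact Or.inr ⟨h, hkm.trans h'⟩
    · intro k
      by_cases hk : n ≤ k
      · rw [htop k hk]; exact hk
      by_contra! hlt
      have key : ∀ i ∈ Finset.range (k + 1), ∃ v ∈ Finset.range k,
          ∃ h : i < n, (π ⟨i, h⟩ : ℕ) = v := by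
        intro i hi
        rw [Finset.mem_range] at hi
        have hin : i < n := by omega
        refine ⟨π ⟨i, hin⟩, ?_, hin, rfl⟩
        rw [Finset.mem_range]
        by_contra! hcon
        have := hmin (k := k) (i := i) (Or.inr ⟨hin, hcon⟩)
        omega
      choose! f hf hfn hfv using key
      have hinj : Set.InjOn f (Finset.range (k + 1)) := by
        intro x hx y hy hxy
        have : π ⟨x, hfn x hx⟩ = π ⟨y, hfn y hy⟩ :=
          Fin.ext (by rw [hfv x hx, hfv y hy, hxy])
        exact congrArg Fin.val (π.injective this)
      have := Finset.card_le_card_of_injOn f hf hinj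
      simp at this
  have hrec : ∀ a : Fin n, (∀ k < n, c k ≠ a) → ∃ b < a, π a < π b := by
    intro a ha
    by_contra! hcon
    refine ha (π a) (π a).2 (le_antisymm (hmin (Or.inr ⟨a.2, le_rfl⟩)) ?_)
    by_contra! hlt
    rcases hspec (π a) with h | ⟨h, h'⟩
    · have := a.2
      omega
    · have h2 := hcon ⟨_, h⟩ hlt
      exact hlt.ne (congrArg Fin.val (π.injective (le_antisymm h2 h')))
  refine ⟨c, hc, htop, ?_, ?_⟩
  · intro k hk hlast
    have hcn : c k < n := (hc.le k).trans_lt hk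
    refine ⟨hcn, ?_⟩
    rcases hspec k with h | ⟨h, h'⟩
    · omega
    · by_contra hne
      have := hmin (k := k + 1) (i := c k) (Or.inr ⟨h, by omega⟩)
      omega
  · intro a b hab ha hb
    by_contra! hle
    have hlt : π b < π a := lt_of_le_of_ne hle fun e => hab.ne' (π.injective e)
    obtain ⟨a', ha', hπa⟩ := hrec a ha
    refine hπ ⟨![a', a, b], ?_, ?_⟩
    · rw [Fin.strictMono_iff_lt_succ]
      intro i
      fin_cases i
      · exact ha'
      · exact hab
    · have h3 := hlt.trans hπa
      intro j k
      fin_cases j <;> fin_cases k <;>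
        simp [p321, hlt, hπa, h3, hlt.le, hπa.le, h3.le]

/-! ## Enumerations of trees -/

/-- `v 0, …, v n` is the increasing enumeration of `t`. -/
structure IsEnum (n : ℕ) (t : Set Vertex) (v : ℕ → Vertex) : Prop where
  strictMonoOn : StrictMonoOn v (Set.Iic n)
  image_eq : v '' Set.Iic n = t

/-- The vertex of height `h` following `v` in a depth-first exploration. -/
def nextVertex (v : Vertex) (h : ℕ) : Vertex :=
  v.take (h - 1) ++ [(v.map (· + 1)).getD (h - 1) 0]

lemma eq_or_of_le_of_lt_append {u v : Vertex} {i : ℕ} (h1 : u ≤ v) (h2 : v < u ++ [i]) :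
    v = u ∨ ∃ k < i, ∃ r, v = u ++ k :: r := by
  induction u generalizing v with
  | nil =>
    cases v with
    | nil => exact Or.inl rfl
    | cons k r =>
      rw [List.nil_append, List.cons_lt_cons_iff] at h2
      rcases h2 with h | ⟨-, h⟩
      · exact Or.inr ⟨k, h, r, rfl⟩
      · exact absurd h (List.not_lt_nil _)
  | cons a u ih =>
    cases v with
    | nil => exact absurd h1 (not_le.2 (List.nil_lt_cons _ _))
    | cons b v =>
      rw [List.cons_append, List.cons_lt_cons_iff] at h2
      rw [← not_lt, List.cons_lt_cons_iff] at h1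
      obtain ⟨rfl, h2'⟩ := h2.resolve_left fun h => h1 (Or.inl h)
      have h1' : u ≤ v := not_lt.1 fun h => h1 (Or.inr ⟨rfl, h⟩)
      rcases ih h1' h2' with h | ⟨k, hk, r, hr⟩
      · exact Or.inl (by rw [h])
      · exact Or.inr ⟨k, hk, r, by rw [hr]; rfl⟩

lemma lt_append_singleton (u : Vertex) (i : ℕ) : u < u ++ [i] := by
  induction u with
  | nil => exact List.nil_lt_cons _ _
  | cons a u ih => exact List.cons_lt_cons_iff.2 (Or.inr ⟨rfl, ih⟩)

lemma append_lt_append_left (u : Vertex) {x y : Vertex} (h : x < y) : u ++ x < u ++ y := by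
  induction u with
  | nil => exact h
  | cons a u ih => exact List.cons_lt_cons_iff.2 (Or.inr ⟨rfl, ih⟩)

lemma nextVertex_append (u : Vertex) (k : ℕ) (r : Vertex) :
    nextVertex (u ++ k :: r) (u.length + 1) = u ++ [k + 1] := by
  simp [nextVertex]

lemma nextVertex_length_succ (u : Vertex) : nextVertex u (u.length + 1) = u ++ [0] := by
  simp [nextVertex]

/-- A height at most `|v| + 1` either is `|v| + 1` or selects an ancestor edge of `v`. -/
lemma eq_or_exists_append (v : Vertex) {h : ℕ} (h1 : 1 ≤ h) (h2 : h ≤ v.length + 1) :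
    h = v.length + 1 ∨ ∃ u k r, v = u ++ k :: r ∧ h = u.length + 1 := by
  rcases h2.eq_or_lt with h' | h'
  · exact Or.inl h'
  · refine Or.inr ⟨v.take (h - 1), v[h - 1]'(by omega), v.drop h, ?_, ?_⟩
    · conv_lhs => rw [← List.take_append_drop (h - 1) v,
        List.drop_eq_getElem_cons (show h - 1 < v.length by omega)]
      rw [Nat.sub_add_cancel h1]
    · rw [List.length_take]; omega

lemma length_nextVertex {v : Vertex} {h : ℕ} (h1 : 1 ≤ h) (h2 : h ≤ v.length + 1) :
    (nextVertex v h).length = h := by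
  rcases eq_or_exists_append v h1 h2 with rfl | ⟨u, k, r, rfl, rfl⟩
  · rw [nextVertex_length_succ]; simp
  · rw [nextVertex_append]; simp

lemma lt_nextVertex {v : Vertex} {h : ℕ} (h1 : 1 ≤ h) (h2 : h ≤ v.length + 1) :
    v < nextVertex v h := by
  rcases eq_or_exists_append v h1 h2 with rfl | ⟨u, k, r, rfl, rfl⟩
  · rw [nextVertex_length_succ]; exact lt_append_singleton _ _
  · rw [nextVertex_append]
    exact append_lt_append_left _ (List.cons_lt_cons_iff.2 (Or.inl (Nat.lt_succ_self k)))

lemma IsTree.insert_nextVertex {t : Set Vertex} (ht : IsTree t) {v : Vertex} (hv : v ∈ t)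
    {h : ℕ} (h1 : 1 ≤ h) (h2 : h ≤ v.length + 1) : IsTree (insert (nextVertex v h) t) := by
  obtain ⟨u, i, hui, hu, hi⟩ : ∃ u i, nextVertex v h = u ++ [i] ∧ u ∈ t ∧
      ∀ j < i, u ++ [j] ∈ t := by
    rcases eq_or_exists_append v h1 h2 with rfl | ⟨u, k, r, rfl, rfl⟩
    · exact ⟨v, 0, nextVertex_length_succ v, hv, by simp⟩
    · refine ⟨u, k + 1, nextVertex_append u k r, ht.2.1 _ _ hv, fun j hj => ?_⟩
      refine ht.2.2 u k j (ht.2.1 _ r ?_) (by omega)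
      simpa using hv
  rw [hui]
  refine ⟨Or.inr ht.1, ?_, ?_⟩
  · rintro x y (hxy | hxy)
    · rcases List.eq_nil_or_concat y with rfl | ⟨y', b, rfl⟩
      · left; simpa using hxy
      · right
        rw [List.concat_eq_append, ← List.append_assoc] at hxy
        have := (List.append_inj' hxy rfl).1
        exact ht.2.1 x y' (this ▸ hu)
    · exact Or.inr (ht.2.1 _ _ hxy)
  · rintro x a b (hxa | hxa) hba
    · obtain ⟨rfl, hai⟩ := List.append_inj' hxa rfl
      obtain rfl : a = i := by simpa using hai
      rcases hba.eq_or_lt with rfl | hlt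
      · exact Or.inl rfl
      · exact Or.inr (hi b hlt)
    · exact Or.inr (ht.2.2 _ _ _ hxa hba)

lemma exists_isEnum {n : ℕ} {t : Set Vertex} (ht : t.encard = (n : ℕ∞) + 1) :
    ∃ v, IsEnum n t v := by
  have hcard : t.encard = ((n + 1 : ℕ) : ℕ∞) := by simpa using ht
  have hfin : t.Finite := Set.finite_of_encard_eq_coe hcard
  have hc : hfin.toFinset.card = n + 1 := by
    rw [hfin.encard_eq_coe_toFinset_card] at hcard
    exact_mod_cast hcard
  let e := hfin.toFinset.orderEmbOfFin hc
  have he : ∀ i (h : i < n + 1), (fun i => if h : i < n + 1 then e ⟨i, h⟩ else []) i = e ⟨i, h⟩ :=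
    fun i h => dif_pos h
  refine ⟨fun i => if h : i < n + 1 then e ⟨i, h⟩ else [], ?_, ?_⟩
  · intro i hi j hj hij
    rw [he i (Nat.lt_succ_of_le hi), he j (Nat.lt_succ_of_le hj)]
    exact e.strictMono hij
  · ext x
    have hr : x ∈ Set.range e ↔ x ∈ t := by simp [e]
    rw [← hr]
    constructor
    · rintro ⟨i, hi, rfl⟩
      rw [he i (Nat.lt_succ_of_le hi)]
      exact ⟨_, rfl⟩
    · rintro ⟨i, rfl⟩
      exact ⟨i, Nat.le_of_lt_succ i.2, he i i.2⟩

namespace IsEnum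

variable {n : ℕ} {t : Set Vertex} {v : ℕ → Vertex}

lemma mem (h : IsEnum n t v) {i : ℕ} (hi : i ≤ n) : v i ∈ t :=
  h.image_eq ▸ Set.mem_image_of_mem v hi

lemma exists_eq (h : IsEnum n t v) {x : Vertex} (hx : x ∈ t) : ∃ i ≤ n, v i = x := by
  rw [← h.image_eq] at hx
  exact hx

lemma lt_iff (h : IsEnum n t v) {i j : ℕ} (hi : i ≤ n) (hj : j ≤ n) : v i < v j ↔ i < j :=
  h.strictMonoOn.lt_iff_lt hi hj

lemma le_of_lt_succ (h : IsEnum n t v) {j : ℕ} (hj : j < n) {x : Vertex} (hx : x ∈ t)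
    (hlt : x < v (j + 1)) : x ≤ v j := by
  obtain ⟨i, hi, rfl⟩ := h.exists_eq hx
  rw [h.lt_iff hi hj] at hlt
  exact (h.strictMonoOn.le_iff_le hi (show j ∈ Set.Iic n from hj.le)).2 (by omega)

lemma ncard_lt (h : IsEnum n t v) {j : ℕ} (hj : j ≤ n) : {x ∈ t | x < v j}.ncard = j := by
  have : {x ∈ t | x < v j} = v '' (Finset.range j : Set ℕ) := by
    ext x
    constructor
    · rintro ⟨hx, hlt⟩
      obtain ⟨i, hi, rfl⟩ := h.exists_eq hx
      exact ⟨i, by simpa using (h.lt_iff hi hj).1 hlt, rfl⟩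
    · rintro ⟨i, hi, rfl⟩
      have hi' : i < j := by simpa using hi
      exact ⟨h.mem (by omega), (h.lt_iff (by omega) hj).2 hi'⟩
  rw [this, Set.InjOn.ncard_image, Set.ncard_coe_finset, Finset.card_range]
  refine h.strictMonoOn.injOn.mono fun i hi => ?_
  have hi' : i < j := by simpa using hi
  exact (hi'.le.trans hj : i ≤ n)

lemma encard_eq (h : IsEnum n t v) : t.encard = (n : ℕ∞) + 1 := by
  have hIic : Set.Iic n = ((Finset.range (n + 1) : Finset ℕ) : Set ℕ) := by
    ext; simp
  rw [← h.image_eq, h.strictMonoOn.injOn.encard_image, hIic, Set.encard_coe_eq_coe_finsetCard]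
  simp

lemma zero (ht : IsTree t) (h : IsEnum n t v) : v 0 = [] := by
  obtain ⟨i, hi, hiv⟩ := h.exists_eq ht.1
  have : v 0 ≤ v i := (h.strictMonoOn.le_iff_le (Nat.zero_le n) hi).2 (Nat.zero_le i)
  rw [hiv] at this
  cases hv : v 0 with
  | nil => rfl
  | cons a l => exact absurd (hv ▸ this) (not_le.2 (List.nil_lt_cons _ _))

lemma step (ht : IsTree t) (h : IsEnum n t v) {j : ℕ} (hj : j < n) :
    1 ≤ (v (j + 1)).length ∧ (v (j + 1)).length ≤ (v j).length + 1 ∧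
      v (j + 1) = nextVertex (v j) (v (j + 1)).length := by
  have hlt : v j < v (j + 1) := (h.lt_iff hj.le hj).2 (Nat.lt_succ_self j)
  have hmem := h.mem (show j + 1 ≤ n from hj)
  have hle := fun {x} => h.le_of_lt_succ hj (x := x)
  generalize v (j + 1) = w at *
  generalize v j = x at *
  rcases List.eq_nil_or_concat w with rfl | ⟨u, i, rfl⟩
  · exact absurd hlt (List.not_lt_nil _)
  rw [List.concat_eq_append] at *
  have hux := hle (ht.2.1 _ _ hmem) (lt_append_singleton u i)
  rcases eq_or_of_le_of_lt_append hux hlt with rfl | ⟨k, hk, r, rfl⟩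
  · obtain rfl : i = 0 := by
      by_contra hi
      have h1 := hle (ht.2.2 x i 0 hmem (Nat.zero_le i)) (append_lt_append_left _
        (List.cons_lt_cons_iff.2 (Or.inl (Nat.pos_of_ne_zero hi))))
      exact absurd h1 (not_le.2 (lt_append_singleton _ _))
    simp [nextVertex_length_succ]
  · obtain rfl : i = k + 1 := by
      by_contra hi
      have h1 := hle (ht.2.2 u i (k + 1) hmem (by omega)) (append_lt_append_left _
        (List.cons_lt_cons_iff.2 (Or.inl (by omega))))
      exact absurd h1 (not_le.2 (append_lt_append_left _
        (List.cons_lt_cons_iff.2 (Or.inl (Nat.lt_succ_self k)))))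
    simp [nextVertex_append]

lemma isLeaf_iff (ht : IsTree t) (h : IsEnum n t v) {j : ℕ} (hj : j < n) :
    IsLeaf t (v j) ↔ (v (j + 1)).length ≤ (v j).length := by
  obtain ⟨-, hle, hnext⟩ := h.step ht hj
  constructor
  · intro hl
    by_contra! hlt
    rw [show (v (j + 1)).length = (v j).length + 1 by omega, nextVertex_length_succ] at hnext
    exact hl.2 0 (hnext ▸ h.mem hj)
  · intro hlen
    refine ⟨h.mem hj.le, fun i hi => ?_⟩
    have h0 := ht.2.2 _ i 0 hi (Nat.zero_le i)
    have hlt : v j < v (j + 1) := (h.lt_iff hj.le hj).2 (Nat.lt_succ_self j)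
    have hge : v (j + 1) ≤ v j ++ [0] := by
      by_contra! hcon
      exact absurd (h.le_of_lt_succ hj h0 hcon) (not_le.2 (lt_append_singleton _ _))
    rcases hge.eq_or_lt with he | hl
    · rw [he] at hlen
      simp at hlen
    · rcases eq_or_of_le_of_lt_append hlt.le hl with he | ⟨k, hk, -⟩
      · exact hlt.ne' he
      · omega

lemma isLeaf_last (h : IsEnum n t v) : IsLeaf t (v n) := by
  refine ⟨h.mem le_rfl, fun i hi => ?_⟩
  obtain ⟨j, hj, hjv⟩ := h.exists_eq hi
  have := lt_append_singleton (v n) i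
  rw [← hjv, h.lt_iff le_rfl hj] at this
  omega

lemma length_le (ht : IsTree t) (h : IsEnum n t v) {j : ℕ} (hj : j ≤ n) :
    (v j).length ≤ j := by
  induction j with
  | zero => simp [h.zero ht]
  | succ j ih =>
    have := (h.step ht hj).2.1
    have := ih (by omega)
    omega

lemma eq_of_length_eq {t' : Set Vertex} {v' : ℕ → Vertex} (ht : IsTree t) (ht' : IsTree t')
    (h : IsEnum n t v) (h' : IsEnum n t' v')
    (hlen : ∀ k < n, (v (k + 1)).length = (v' (k + 1)).length) : t = t' := by
  have hv : ∀ j ≤ n, v j = v' j := by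
    intro j hj
    induction j with
    | zero => rw [h.zero ht, h'.zero ht']
    | succ j ih =>
      rw [(h.step ht hj).2.2, (h'.step ht' hj).2.2, ih (by omega), hlen j hj]
  rw [← h.image_eq, ← h'.image_eq]
  exact Set.image_congr hv

end IsEnum

/-- The code of a tree with increasing enumeration `v 0, …, v n`. -/
def treeCode (n : ℕ) (v : ℕ → Vertex) (k : ℕ) : ℕ :=
  if k < n then k + 1 - (v (k + 1)).length else n

namespace IsEnum

variable {n : ℕ} {t : Set Vertex} {v : ℕ → Vertex}

lemma isCode (ht : IsTree t) (h : IsEnum n t v) : IsCode n (treeCode n v) := by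
  have hle : ∀ k, treeCode n v k ≤ k := by
    intro k
    unfold treeCode
    split_ifs with hk
    · have := (h.step ht hk).1
      omega
    · omega
  refine ⟨monotone_nat_of_le_succ fun k => ?_, hle, by simp [treeCode]⟩
  have hk' := hle k
  by_cases hk : k + 1 < n
  · have h1 := (h.step ht hk).2.1
    have h2 := h.length_le ht hk
    simp only [treeCode, hk, show k < n by omega, if_true]
    omega
  · by_cases hk2 : k < n
    · simp only [treeCode, hk, if_false] at hk' ⊢
      omega
    · simp [treeCode, hk, hk2]

lemma isLeaf_succ_iff (ht : IsTree t) (h : IsEnum n t v) {k : ℕ} (hk : k < n) :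
    IsLeaf t (v (k + 1)) ↔ treeCode n v k < treeCode n v (k + 1) := by
  by_cases hk' : k + 1 < n
  · have h1 := h.length_le ht (show k + 1 ≤ n by omega)
    have h2 := h.length_le ht (show k + 1 + 1 ≤ n by omega)
    rw [h.isLeaf_iff ht hk']
    simp only [treeCode, hk, hk', if_true]
    omega
  · obtain rfl : n = k + 1 := by omega
    have := (h.step ht hk).1
    simp only [h.isLeaf_last, treeCode, hk, hk', if_true, if_false, true_iff]
    omega

lemma is321Image_iff (hn : 1 ≤ n) (ht : IsTree t) (h : IsEnum n t v)
    (π : Equiv.Perm (Fin n)) : Is321Image n t π ↔ IsCodePerm n (treeCode n v) π := by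
  have hc := h.isCode ht
  have hleaf : ∀ x, IsLeaf t x ↔
      ∃ k < n, treeCode n v k < treeCode n v (k + 1) ∧ x = v (k + 1) := by
    intro x
    constructor
    · intro hx
      obtain ⟨j, hj, rfl⟩ := h.exists_eq hx.1
      cases j with
      | zero =>
        have h1 := (h.step ht hn).1
        have h0 := (h.isLeaf_iff ht hn).1 hx
        rw [h.zero ht, List.length_nil] at h0
        omega
      | succ k => exact ⟨k, hj, (h.isLeaf_succ_iff ht hj).1 hx, rfl⟩
    · rintro ⟨k, hk, hlast, rfl⟩
      exact (h.isLeaf_succ_iff ht hk).2 hlast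
  have hpos : ∀ k < n, {x ∈ t | x < v (k + 1)}.ncard - (v (k + 1)).length = treeCode n v k := by
    intro k hk
    rw [h.ncard_lt hk, treeCode, if_pos hk]
  have hval : ∀ k < n, {x ∈ t | x < v (k + 1)}.ncard - 1 = k := by
    intro k hk
    rw [h.ncard_lt hk, Nat.succ_sub_one]
  have hB : ∀ a : ℕ, (∀ x, IsLeaf t x → {y ∈ t | y < x}.ncard - x.length ≠ a) ↔
      ∀ k < n, treeCode n v k ≠ a := by
    intro a
    constructor
    · intro H k hk
      obtain ⟨m, -, hm, hcm, hlast⟩ := hc.exists_last hk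
      rw [← hcm, ← hpos m hm]
      exact H _ ((hleaf _).2 ⟨m, hm, hlast, rfl⟩)
    · intro H x hx
      obtain ⟨k, hk, -, rfl⟩ := (hleaf x).1 hx
      rw [hpos k hk]
      exact H k hk
  unfold Is321Image IsCodePerm
  simp only [hB]
  refine and_congr_left fun _ => ?_
  constructor
  · intro H k hk hlast
    have := H _ ((hleaf _).2 ⟨k, hk, hlast, rfl⟩)
    simpa only [hpos k hk, hval k hk] using this
  · intro H x hx
    obtain ⟨k, hk, hlast, rfl⟩ := (hleaf x).1 hx
    simpa only [hpos k hk, hval k hk] using H k hk hlast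

end IsEnum

/-- The depth-first sequence of vertices whose heights are prescribed by the code `c`. -/
def codeVertex (c : ℕ → ℕ) : ℕ → Vertex
  | 0 => []
  | k + 1 => nextVertex (codeVertex c k) (k + 1 - c k)

lemma IsCode.exists_tree {n : ℕ} {c : ℕ → ℕ} (hc : IsCode n c) (htop : ∀ k, n ≤ k → c k = n) :
    ∃ t v, IsTree t ∧ IsEnum n t v ∧ treeCode n v = c := by
  have hb : ∀ k ≤ n, (k < n → 1 ≤ k + 1 - c k ∧ k + 1 - c k ≤ (codeVertex c k).length + 1) ∧
      ∀ j, k = j + 1 → (codeVertex c k).length = j + 1 - c j := by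
    intro k hk
    induction k with
    | zero => simp [codeVertex, Nat.le_zero.1 (hc.le 0)]
    | succ k ih =>
      obtain ⟨h1, h2⟩ := (ih (by omega)).1 hk
      have hl : (codeVertex c (k + 1)).length = k + 1 - c k := length_nextVertex h1 h2
      refine ⟨fun _ => ?_, fun j hj => ?_⟩
      · have := hc.mono (Nat.le_succ k)
        have := hc.le (k + 1)
        have := hc.le k
        simp only [Nat.succ_eq_add_one] at *
        omega
      · obtain rfl : k = j := by omega
        exact hl
  have hmono : StrictMonoOn (codeVertex c) (Set.Iic n) := by
    refine strictMonoOn_of_lt_add_one Set.ordConnected_Iic fun k _ _ hk => ?_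
    obtain ⟨h1, h2⟩ := (hb k (Nat.le_of_succ_le hk)).1 hk
    exact lt_nextVertex h1 h2
  have htree : ∀ k ≤ n, IsTree (codeVertex c '' Set.Iic k) := by
    intro k hk
    induction k with
    | zero =>
      refine ⟨⟨0, by simp, rfl⟩, ?_, ?_⟩
      · rintro x y ⟨i, hi, hxy⟩
        obtain rfl : i = 0 := by simpa using hi
        have : x = [] ∧ y = [] := by simpa [codeVertex] using hxy.symm
        exact ⟨0, by simp, this.1.symm⟩
      · rintro x a b ⟨i, hi, hxy⟩
        obtain rfl : i = 0 := by simpa using hi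
        simp [codeVertex] at hxy
    | succ k ih =>
      obtain ⟨h1, h2⟩ := (hb k (by omega)).1 hk
      have hI : Set.Iic (k + 1) = insert (k + 1) (Set.Iic k) := by
        ext i; simp only [Set.mem_Iic, Set.mem_insert_iff]; omega
      rw [hI, Set.image_insert_eq]
      exact (ih (by omega)).insert_nextVertex ⟨k, by simp, rfl⟩ h1 h2
  refine ⟨_, codeVertex c, htree n le_rfl, ⟨hmono, rfl⟩, ?_⟩
  ext k
  unfold treeCode
  split_ifs with hk
  · rw [(hb (k + 1) hk).2 k rfl]
    have := hc.le k
    omega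
  · exact (htop k (by omega)).symm

/-! ## The bijections -/

lemma existsUnique_is321Image {n : ℕ} (hn : 1 ≤ n) {t : Set Vertex} (ht : IsTree t)
    (hcard : t.encard = (n : ℕ∞) + 1) : ∃! π : Equiv.Perm (Fin n), Is321Image n t π := by
  obtain ⟨v, hv⟩ := exists_isEnum hcard
  have hc := hv.isCode ht
  obtain ⟨π, hπ⟩ := hc.exists_perm
  exact ⟨π, (hv.is321Image_iff hn ht π).2 hπ, fun ρ hρ =>
    IsCodePerm.perm_unique hc ((hv.is321Image_iff hn ht ρ).1 hρ) hπ⟩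

lemma bijOn_321 {n : ℕ} (hn : 1 ≤ n) {Φ : TreeN n → Equiv.Perm (Fin n)}
    (hΦ : ∀ t : TreeN n, Is321Image n t.1 (Φ t)) :
    Set.BijOn Φ Set.univ {π : Equiv.Perm (Fin n) | AvoidsPat π p321} := by
  refine ⟨?_, ?_, ?_⟩
  · intro t _
    obtain ⟨v, hv⟩ := exists_isEnum t.2.2
    exact ((hv.is321Image_iff hn t.2.1 _).1 (hΦ t)).avoids (hv.isCode t.2.1)
  · intro t _ t' _ htt
    obtain ⟨v, hv⟩ := exists_isEnum t.2.2
    obtain ⟨v', hv'⟩ := exists_isEnum t'.2.2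
    have h := (hv.is321Image_iff hn t.2.1 _).1 (hΦ t)
    have h' := (hv'.is321Image_iff hn t'.2.1 _).1 (hΦ t')
    rw [← htt] at h'
    have hcc := h.code_unique (hv.isCode t.2.1) (hv'.isCode t'.2.1) h'
    refine Subtype.ext (hv.eq_of_length_eq t.2.1 t'.2.1 hv' fun k hk => ?_)
    have h1 := hv.length_le t.2.1 (show k + 1 ≤ n from hk)
    have h2 := hv'.length_le t'.2.1 (show k + 1 ≤ n from hk)
    have h3 := hcc k hk
    simp only [treeCode, hk, if_true] at h3
    omega
  · intro π hπ
    obtain ⟨c, hc, htop, hcπ⟩ := AvoidsPat.exists_code hπ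
    obtain ⟨t, v, ht, hv, rfl⟩ := hc.exists_tree htop
    refine ⟨⟨t, ht, hv.encard_eq⟩, Set.mem_univ _, ?_⟩
    exact (existsUnique_is321Image hn ht hv.encard_eq).unique (hΦ ⟨t, ht, hv.encard_eq⟩)
      ((hv.is321Image_iff hn ht π).2 hcπ)

lemma avoidsPat_trans_revPerm_iff {n : ℕ} (π : Equiv.Perm (Fin n)) :
    AvoidsPat (π.trans Fin.revPerm) p123 ↔ AvoidsPat π p321 := by
  have h : ∀ f : Fin 3 → Fin n, ∀ j k : Fin 3,
      (p123 j < p123 k ↔ (π.trans Fin.revPerm) (f j) < (π.trans Fin.revPerm) (f k)) ↔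
        (p321 k < p321 j ↔ π (f k) < π (f j)) := by
    intro f j k
    have : p123 j < p123 k ↔ p321 k < p321 j := by
      fin_cases j <;> fin_cases k <;> simp [p123, p321]
    simp [this]
  unfold AvoidsPat ContainsPat
  simp only [h]
  exact not_congr (exists_congr fun f => and_congr_right fun _ => forall_comm)

lemma is123Image_iff {n : ℕ} {t : Set Vertex} {π : Equiv.Perm (Fin n)} :
    Is123Image n t π ↔ Is321Image n t (π.trans Fin.revPerm) := by
  constructor
  · rintro ⟨ρ, hρ, hπ⟩
    have : π.trans Fin.revPerm = ρ := by ext i; simp [hπ]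
    rwa [this]
  · intro h
    exact ⟨_, h, fun i => by simp⟩

/-- For `σ ∈ {321, 123}`, the map `t ↦ Φ_t^σ` is a well-defined bijection
from the trees with `n+1` vertices onto the set `Av_n(σ)` of `σ`-avoiding permutations
of `[n]`. -/
theorem bijection_321_123 (n : ℕ) (hn : 1 ≤ n) :
    (∀ t : Set Vertex, IsTree t → t.encard = (n : ℕ∞) + 1 →
      ∃! π : Equiv.Perm (Fin n), Is321Image n t π) ∧
    (∀ Φ : TreeN n → Equiv.Perm (Fin n),
      (∀ t : TreeN n, Is321Image n t.1 (Φ t)) →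
      Set.BijOn Φ Set.univ {π : Equiv.Perm (Fin n) | AvoidsPat π p321}) ∧
    (∀ t : Set Vertex, IsTree t → t.encard = (n : ℕ∞) + 1 →
      ∃! π : Equiv.Perm (Fin n), Is123Image n t π) ∧
    (∀ Φ : TreeN n → Equiv.Perm (Fin n),
      (∀ t : TreeN n, Is123Image n t.1 (Φ t)) →
      Set.BijOn Φ Set.univ {π : Equiv.Perm (Fin n) | AvoidsPat π p123}) := by
  have hrev : ∀ π : Equiv.Perm (Fin n), (π.trans Fin.revPerm).trans Fin.revPerm = π :=
    fun π => by ext i; simp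
  refine ⟨fun t ht hcard => existsUnique_is321Image hn ht hcard, fun Φ hΦ => bijOn_321 hn hΦ,
    fun t ht hcard => ?_, fun Φ hΦ => ?_⟩
  · obtain ⟨π, hπ, hu⟩ := existsUnique_is321Image hn ht hcard
    refine ⟨π.trans Fin.revPerm, is123Image_iff.2 (by rwa [hrev]), fun ρ hρ => ?_⟩
    rw [← hu _ (is123Image_iff.1 hρ), hrev]
  · obtain ⟨hmaps, hinj, hsurj⟩ := bijOn_321 hn (Φ := fun t => (Φ t).trans Fin.revPerm)
      fun t => is123Image_iff.1 (hΦ t)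
    refine ⟨fun t ht => ?_, fun t ht t' ht' htt => hinj ht ht' ?_, fun π hπ => ?_⟩
    · have h := (avoidsPat_trans_revPerm_iff _).2 (hmaps ht)
      rwa [hrev] at h
    · simp only [htt]
    · rw [Set.mem_ofPred_eq, ← hrev π, avoidsPat_trans_revPerm_iff] at hπ
      obtain ⟨t, ht, h⟩ := hsurj hπ
      refine ⟨t, ht, ?_⟩
      rw [← hrev (Φ t), ← hrev π]
      exact congrArg (fun ρ : Equiv.Perm (Fin n) => ρ.trans Fin.revPerm) h

end AvoidPaper
end
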